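/- In every stochastic game, for every ε > 0 and every player i ∈ I there exists a bounded function D_i^ε : H → ℝ (a Martin function for the minmax value) such that: (1) v̄_i(h) − ε ≤ D_i^ε(h) ≤ v̄_i(h) for every history h ∈ H; (2) D_i^ε(h) ≤ v̄_{O,i}(D_i^ε,h) for every history h ∈ H; and (3) for every history h' ∈ H and every strategy profile σ, if v̄_{O,i}(D_i^ε,h) ≤ E[D_i^ε | h, σ(h)] for every history h extending h' (including h'), then v̄_{O,i}(D_i^ε,h) ≤ E_{h,σ}[f_i] for every history h extending h' (including h'). -/

import Mathlib

open scoped ENNReal NNReal Classical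

/-- A multiplayer stochastic game: a nonempty finite set of players `I`, a nonempty
countable set of states `S`, nonempty finite action sets `A i`, a transition function
`trans` and bounded Borel payoff functions `payoff i` on runs. -/
structure StochGame where
  I : Type
  S : Type
  A : I → Type
  [fintypeI : Fintype I]
  [nonemptyI : Nonempty I]
  [countableS : Countable S]
  [nonemptyS : Nonempty S]
  [fintypeA : ∀ i, Fintype (A i)]
  [nonemptyA : ∀ i, Nonempty (A i)]
  trans : S → (∀ i, A i) → PMF S
  payoff : I → S × (ℕ → (∀ i, A i) × S) → ℝ

open MeasureTheory

attribute [instance] StochGame.fintypeI StochGame.nonemptyI StochGame.countableS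
  StochGame.nonemptyS StochGame.fintypeA StochGame.nonemptyA

namespace StochGame

variable (G : StochGame)

noncomputable instance : DecidableEq G.I := Classical.decEq _

noncomputable instance (i : G.I) : DecidableEq (G.A i) := Classical.decEq _

/-- Action profiles. -/
abbrev ActionProfile := ∀ i, G.A i

/-- Runs `(s¹,a¹,s²,a²,…)`, encoded as an initial state together with a sequence of
(action profile, next state) pairs. -/
abbrev Run := G.S × (ℕ → G.ActionProfile × G.S)

/-- Histories `(s¹,a¹,…,s^n)`, encoded as an initial state together with a finite list of
(action profile, next state) pairs. -/
abbrev History := G.S × List (G.ActionProfile × G.S)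

instance : MeasurableSpace G.S := ⊤
instance : MeasurableSpace G.ActionProfile := ⊤

variable {G}

/-- The final state `s_h` of a history. -/
def lastState (h : G.History) : G.S := h.2.getLast?.elim h.1 Prod.snd

/-- The stage (length) of a history: a history `(s¹,a¹,…,s^n)` is in stage `n`. -/
def stage (h : G.History) : ℕ := h.2.length + 1

/-- The history obtained by appending one action profile and one state. -/
def snocH (h : G.History) (a : G.ActionProfile) (s : G.S) : G.History :=
  (h.1, h.2 ++ [(a, s)])

/-- The history obtained by appending a finite list of (action profile, state) pairs. -/
def catH (h : G.History) (l : List (G.ActionProfile × G.S)) : G.History := (h.1, h.2 ++ l)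

/-- The history in stage 1 consisting of the initial state `s` only. -/
def initH (G : StochGame) (s : G.S) : G.History := (s, [])

/-- All transitions along the list have positive probability when starting from `s`. -/
def ValidFrom (G : StochGame) : G.S → List (G.ActionProfile × G.S) → Prop
  | _, [] => True
  | s, (a, t) :: l => G.trans s a t ≠ 0 ∧ ValidFrom G t l

/-- A history belongs to the set `H` of histories of the game iff all its transitions have
positive probability. -/
def Valid (h : G.History) : Prop := ValidFrom G h.1 h.2

/-- `Ext h h'` means that the history `h'` extends the history `h` (possibly `h = h'`),
written `h ⪯ h'` in the paper. -/
def Ext (h h' : G.History) : Prop := h.1 = h'.1 ∧ h.2 <+: h'.2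

/-- A behavior strategy of player `i`: a mixed action at every history. -/
abbrev Strategy (G : StochGame) (i : G.I) := G.History → PMF (G.A i)

/-- A strategy profile: one behavior strategy for each player. -/
abbrev Profile (G : StochGame) := ∀ i, G.Strategy i

/-- The probability, under the strategy profile `σ`, that after the history `h` play continues
exactly along the finite continuation `l`. -/
noncomputable def contProb (σ : G.Profile) : G.History → List (G.ActionProfile × G.S) → ℝ≥0∞
  | _, [] => 1
  | h, (a, s) :: l =>
      (∏ i, σ i h (a i)) * G.trans (lastState h) a s * contProb σ (snocH h a s) l

/-- The cylinder set `C(h)` of all runs extending the history `h`. -/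
def cyl (h : G.History) : Set G.Run :=
  {r | r.1 = h.1 ∧ ∀ k, (hk : k < h.2.length) → r.2 k = h.2.get ⟨k, hk⟩}

/-- `P` is the family of probability measures `P_{h,σ}` on runs induced, via the
Ionescu-Tulcea/Kolmogorov extension, by a history `h` and a strategy profile `σ`:
each `P h σ` is a probability measure, and the measure of the cylinder set of any finite
extension of `h` is the product of the transition probabilities prescribed by `σ` and `p`.
(These properties determine `P h σ` uniquely, since `P h σ (cyl h) = 1`.) -/
def IsInducedFamily (G : StochGame) (P : G.History → G.Profile → Measure G.Run) : Prop :=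
  (∀ h σ, IsProbabilityMeasure (P h σ)) ∧
    ∀ (h : G.History) (σ : G.Profile) (l : List (G.ActionProfile × G.S)),
      P h σ (cyl (catH h l)) = contProb σ h l

/-- The expected payoff `E_{h,σ}[f_i]` of player `i` in the subgame at `h` under `σ`. -/
noncomputable def expPay (P : G.History → G.Profile → Measure G.Run) (h : G.History)
    (σ : G.Profile) (i : G.I) : ℝ :=
  ∫ r, G.payoff i r ∂(P h σ)

/-- The minmax value `v̄_i(h)` of player `i` at the history `h`. -/
noncomputable def minmaxVal (P : G.History → G.Profile → Measure G.Run) (i : G.I)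
    (h : G.History) : ℝ :=
  ⨅ σ : G.Profile, ⨆ τ : G.Strategy i, expPay P h (Function.update σ i τ) i

/-- The maxmin value `v̲_i(h)` of player `i` at the history `h`. -/
noncomputable def maxminVal (P : G.History → G.Profile → Measure G.Run) (i : G.I)
    (h : G.History) : ℝ :=
  ⨆ τ : G.Strategy i, ⨅ σ : G.Profile, expPay P h (Function.update σ i τ) i

/-- `E[D | h, x]`: the expected value of `D` at the next history, when at history `h` the
players use the mixed action profile `x` and the next state is drawn according to `p`. -/
noncomputable def oneShotExp (D : G.History → ℝ) (h : G.History) (x : ∀ i, PMF (G.A i)) : ℝ :=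
  ∑ a : G.ActionProfile, (∏ i, (x i (a i)).toReal) *
    ∑' s : G.S, (G.trans (lastState h) a s).toReal * D (snocH h a s)

/-- The minmax value `v̄_{O,i}(D,h)` of player `i` in the one-shot game `G_O(D,h)`. -/
noncomputable def oneShotMinmax (D : G.History → ℝ) (i : G.I) (h : G.History) : ℝ :=
  ⨅ x : ∀ j, PMF (G.A j), ⨆ y : PMF (G.A i), oneShotExp D h (Function.update x i y)

/-- The maxmin value `v̲_{O,i}(D,h)` of player `i` in the one-shot game `G_O(D,h)`. -/
noncomputable def oneShotMaxmin (D : G.History → ℝ) (i : G.I) (h : G.History) : ℝ :=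
  ⨆ y : PMF (G.A i), ⨅ x : ∀ j, PMF (G.A j), oneShotExp D h (Function.update x i y)

end StochGame

open scoped ENNReal NNReal Classical

namespace BD

/-- A pruned tree (forest), given by its nodes, levels and a parent map. -/
structure Tr where
  V : Type
  lvl : V → ℕ
  par : V → V
  lvl_par : ∀ v, lvl (par v) = lvl v - 1
  ex_child : ∀ v, ∃ w, lvl w = lvl v + 1 ∧ par w = v

namespace Tr
variable (T : Tr)

/-- `w` is a child of `v`. -/
def Ch (v w : T.V) : Prop := T.lvl w = T.lvl v + 1 ∧ T.par w = v

/-- infinite branches -/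
def IsRun (x : ℕ → T.V) : Prop := ∀ n, T.lvl (x n) = n ∧ T.par (x (n+1)) = x n

/-- strategies (for both players at once) -/
abbrev Strat := {s : T.V → T.V // ∀ v, T.Ch v (s v)}

/-- the run `x` follows `s` at the levels of parity `b` -/
def Conform (b : ℕ) (s : T.Strat) (x : ℕ → T.V) : Prop := ∀ n, n % 2 = b → x (n+1) = s.1 (x n)

def Op (A : Set (ℕ → T.V)) : Prop :=
  ∀ x, T.IsRun x → x ∈ A → ∃ n, ∀ y, T.IsRun y → y n = x n → y ∈ A

def Clo (A : Set (ℕ → T.V)) : Prop := T.Op A ∧ T.Op Aᶜ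

noncomputable def child (v : T.V) : T.V := (T.ex_child v).choose
lemma child_spec (v : T.V) : T.Ch v (T.child v) := (T.ex_child v).choose_spec

noncomputable def dstrat : T.Strat := ⟨T.child, T.child_spec⟩

/-- ancestor at level `n` -/
def anc (v : T.V) (n : ℕ) : T.V := T.par^[T.lvl v - n] v

variable {T}

lemma anc_self (v : T.V) : T.anc v (T.lvl v) = v := by simp [anc]

lemma anc_of_lvl {v : T.V} {n : ℕ} (h : T.lvl v = n) : T.anc v n = v := by
  subst h; exact anc_self v

lemma lvl_iter (v : T.V) (j : ℕ) : T.lvl (T.par^[j] v) = T.lvl v - j := by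
  induction j with
  | zero => rfl
  | succ j ih => rw [Function.iterate_succ_apply', T.lvl_par, ih]; omega

lemma lvl_anc {v : T.V} {n : ℕ} (h : n ≤ T.lvl v) : T.lvl (T.anc v n) = n := by
  rw [anc, lvl_iter]; omega

lemma anc_par {v : T.V} {n : ℕ} (h : n < T.lvl v) : T.anc (T.par v) n = T.anc v n := by
  rw [anc, anc, T.lvl_par, ← Function.iterate_succ_apply]
  congr 1; omega

lemma anc_child {v w : T.V} {n : ℕ} (h : T.Ch v w) (hn : n ≤ T.lvl v) :
    T.anc w n = T.anc v n := by
  rw [← h.2, anc_par]; rw [h.1]; omega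

lemma anc_anc {v : T.V} {m n : ℕ} (h : m ≤ n) (h' : n ≤ T.lvl v) :
    T.anc (T.anc v n) m = T.anc v m := by
  rw [anc, lvl_anc h', anc, ← Function.iterate_add_apply, anc]
  congr 1; omega

lemma par_anc {v : T.V} {n : ℕ} (h : n + 1 ≤ T.lvl v) : T.par (T.anc v (n+1)) = T.anc v n := by
  rw [anc, anc, ← Function.iterate_succ_apply' T.par]
  congr 1; omega

lemma IsRun.ch {x : ℕ → T.V} (hx : T.IsRun x) (n : ℕ) : T.Ch (x n) (x (n+1)) :=
  ⟨by rw [(hx _).1, (hx _).1], (hx n).2⟩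

lemma IsRun.anc {x : ℕ → T.V} (hx : T.IsRun x) {m n : ℕ} (h : n ≤ m) : T.anc (x m) n = x n := by
  induction m, h using Nat.le_induction with
  | base => exact anc_of_lvl (hx n).1
  | succ m hm ih => rw [anc_child (hx.ch m) (by rw [(hx m).1]; exact hm), ih]

lemma IsRun.eq_of_le {x y : ℕ → T.V} (hx : T.IsRun x) (hy : T.IsRun y) {m n : ℕ} (h : n ≤ m)
    (e : x m = y m) : x n = y n := by
  rw [← hx.anc h, ← hy.anc h, e]

/-- from a node, follow a strategy forever -/
lemma exists_run (v : T.V) (s : T.Strat) : ∃ x, T.IsRun x ∧ (∀ n ≤ T.lvl v, x n = T.anc v n) ∧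
    ∀ n, T.lvl v ≤ n → x (n+1) = s.1 (x n) := by
  let x : ℕ → T.V := fun n => if n ≤ T.lvl v then T.anc v n else s.1^[n - T.lvl v] v
  have h2 : ∀ n, T.lvl v ≤ n → x n = s.1^[n - T.lvl v] v := by
    intro n hn
    by_cases h : n ≤ T.lvl v
    · have : n = T.lvl v := le_antisymm h hn
      subst this
      simp [x, anc_self]
    · simp [x, h]
  have h3 : ∀ n, T.lvl v ≤ n → x (n+1) = s.1 (x n) := by
    intro n hn
    rw [h2 n hn, h2 (n+1) (by omega), ← Function.iterate_succ_apply' s.1]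
    congr 1; omega
  have h1 : ∀ n ≤ T.lvl v, x n = T.anc v n := fun n hn => by simp [x, hn]
  have hl : ∀ n, T.lvl v ≤ n → T.lvl (x n) = n := by
    intro n hn
    induction n, hn using Nat.le_induction with
    | base => rw [h1 _ le_rfl, anc_self]
    | succ n hn ih => rw [h3 n hn, (s.2 _).1, ih]
  refine ⟨x, fun n => ⟨?_, ?_⟩, h1, h3⟩
  · by_cases h : n ≤ T.lvl v
    · rw [h1 n h, lvl_anc h]
    · exact hl n (by omega)
  · by_cases h : n + 1 ≤ T.lvl v
    · rw [h1 _ h, h1 n (by omega), par_anc h]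
    · rw [h3 n (by omega), (s.2 _).2]

/-! ### Forcing -/

inductive FR (T : Tr) (b : ℕ) (S U : Set T.V) : Ordinal.{0} → T.V → Prop
  | base {α : Ordinal.{0}} {v : T.V} : v ∈ U → FR T b S U α v
  | mine {α β : Ordinal.{0}} {v w : T.V} : T.lvl v % 2 = b → T.Ch v w → w ∈ S → β < α →
      FR T b S U β w → FR T b S U α v
  | theirs {α : Ordinal.{0}} {v : T.V} (f : T.V → Ordinal.{0}) : T.lvl v % 2 ≠ b →
      (∀ w, T.Ch v w → w ∈ S → f w < α) → (∀ w, T.Ch v w → w ∈ S → FR T b S U (f w) w) →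
      FR T b S U α v

/-- the player of parity `b` can force reaching `U` inside `S` -/
def F (b : ℕ) (S U : Set T.V) (v : T.V) : Prop := ∃ α, FR T b S U α v

noncomputable def rk (b : ℕ) (S U : Set T.V) (v : T.V) : Ordinal.{0} := sInf {α | FR T b S U α v}

variable {b : ℕ} {S U : Set T.V}

lemma F_base {v : T.V} (h : v ∈ U) : F b S U v := ⟨0, .base h⟩

lemma F_mine {v w : T.V} (hb : T.lvl v % 2 = b) (hc : T.Ch v w) (hs : w ∈ S) (hF : F b S U w) :
    F b S U v := by
  obtain ⟨α, h⟩ := hF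
  exact ⟨Order.succ α, .mine hb hc hs (Order.lt_succ α) h⟩

lemma F_theirs {v : T.V} (hb : T.lvl v % 2 ≠ b) (h : ∀ w, T.Ch v w → w ∈ S → F b S U w) :
    F b S U v := by
  let f : T.V → Ordinal.{0} := fun w => if h : F b S U w then h.choose else 0
  refine ⟨⨆ w, Order.succ (f w), .theirs f hb (fun w _ _ => ?_) (fun w h1 h2 => ?_)⟩
  · exact lt_of_lt_of_le (Order.lt_succ _) (Ordinal.le_iSup (fun w => Order.succ (f w)) w)
  · have := h w h1 h2
    simp only [f, this, dif_pos]
    exact this.choose_spec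

lemma FR_rk {v : T.V} (h : F b S U v) : FR T b S U (rk b S U v) v :=
  csInf_mem (s := {α | FR T b S U α v}) h

lemma rk_le {v : T.V} {α} (h : FR T b S U α v) : rk b S U v ≤ α := csInf_le' h

lemma F_mine_step {v : T.V} (h : F b S U v) (hU : v ∉ U) (hb : T.lvl v % 2 = b) :
    ∃ w, T.Ch v w ∧ w ∈ S ∧ F b S U w ∧ rk b S U w < rk b S U v := by
  have := FR_rk h
  generalize hr : rk b S U v = r at this
  cases this with
  | base h => exact absurd h hU
  | mine _ hc hs hlt hf => exact ⟨_, hc, hs, ⟨_, hf⟩, (rk_le hf).trans_lt hlt⟩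
  | theirs f hb' => exact absurd hb hb'

lemma F_theirs_step {v w : T.V} (h : F b S U v) (hU : v ∉ U) (hb : T.lvl v % 2 ≠ b)
    (hc : T.Ch v w) (hs : w ∈ S) :
    F b S U w ∧ rk b S U w < rk b S U v := by
  have := FR_rk h
  generalize hr : rk b S U v = r at this
  cases this with
  | base h => exact absurd h hU
  | mine hb' => exact absurd hb' hb
  | theirs f _ h1 h2 => exact ⟨⟨_, h2 w hc hs⟩, (rk_le (h2 w hc hs)).trans_lt (h1 w hc hs)⟩

/-- the forcing strategy -/
noncomputable def fmove (b : ℕ) (S U : Set T.V) (v : T.V) : T.V :=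
  if h : ∃ w, T.Ch v w ∧ w ∈ S ∧ F b S U w ∧ rk b S U w < rk b S U v then h.choose else T.child v

lemma fmove_ch (v : T.V) : T.Ch v (fmove b S U v) := by
  unfold fmove; split_ifs with h
  · exact h.choose_spec.1
  · exact T.child_spec v

lemma fmove_spec {v : T.V} (h : F b S U v) (hU : v ∉ U) (hb : T.lvl v % 2 = b) :
    fmove b S U v ∈ S ∧ F b S U (fmove b S U v) ∧ rk b S U (fmove b S U v) < rk b S U v := by
  have h' := F_mine_step h hU hb
  unfold fmove; rw [dif_pos h']
  exact h'.choose_spec.2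

lemma no_descent (x : ℕ → T.V) (N : ℕ) (h0 : F b S U (x N))
    (h : ∀ n ≥ N, F b S U (x n) → F b S U (x (n+1)) ∧ rk b S U (x (n+1)) < rk b S U (x n)) :
    False := by
  have hF : ∀ j, F b S U (x (N + j)) := by
    intro j
    induction j with
    | zero => exact h0
    | succ j ih => exact (h _ (by omega) ih).1
  exact (not_strictAnti_of_wellFoundedLT (fun j => rk b S U (x (N + j))))
    (strictAnti_nat_of_succ_lt fun j => (h _ (by omega) (hF j)).2)

/-! ### Open determinacy -/

theorem open_det (v0 : T.V) (A : Set (ℕ → T.V)) (hA : T.Op A) :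
    (∃ s : T.Strat, ∀ x, T.IsRun x → x 0 = v0 → T.Conform 0 s x → x ∈ A) ∨
    (∃ s : T.Strat, ∀ x, T.IsRun x → x 0 = v0 → T.Conform 1 s x → x ∉ A) := by
  let U : Set T.V := {v | ∀ y, T.IsRun y → y (T.lvl v) = v → y ∈ A}
  by_cases hF : F 0 Set.univ U v0
  · left
    refine ⟨⟨fmove 0 Set.univ U, fmove_ch⟩, fun x hx h0 hc => ?_⟩
    by_contra hxA
    have hU : ∀ n, x n ∉ U := fun n hn => hxA (hn x hx (by rw [(hx n).1]))
    refine no_descent (b := 0) (S := Set.univ) (U := U) x 0 (h0 ▸ hF) fun n _ hn => ?_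
    by_cases hb : T.lvl (x n) % 2 = 0
    · rw [hc n (by rwa [(hx n).1] at hb)]
      exact (fmove_spec hn (hU n) hb).2
    · exact F_theirs_step hn (hU n) hb (hx.ch n) trivial
  · right
    have hex : ∀ v, ∃ w, T.Ch v w ∧ (¬ F 0 Set.univ U v → T.lvl v % 2 ≠ 0 →
        ¬ F 0 Set.univ U w) := by
      intro v
      by_cases h : F 0 Set.univ U v ∨ T.lvl v % 2 = 0
      · refine ⟨T.child v, T.child_spec v, fun h1 h2 => ?_⟩
        tauto
      · push Not at h
        by_contra hcon
        push Not at hcon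
        exact h.1 (F_theirs h.2 fun w hw _ => (hcon w hw).2.2)
    choose g hg1 hg2 using hex
    refine ⟨⟨g, hg1⟩, fun x hx h0 hc hxA => ?_⟩
    have hN : ∀ n, ¬ F 0 Set.univ U (x n) := by
      intro n
      induction n with
      | zero => rwa [h0]
      | succ n ih =>
        by_cases hb : T.lvl (x n) % 2 = 0
        · exact fun h => ih (F_mine hb (hx.ch n) trivial h)
        · have : n % 2 = 1 := by rw [(hx n).1] at hb; omega
          rw [hc n this]
          exact hg2 _ ih hb
    obtain ⟨n, hn⟩ := hA x hx hxA
    exact hN n (F_base fun y hy e => hn y hy (by rwa [(hx n).1] at e))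

end Tr
end BD

open scoped ENNReal NNReal Classical

namespace BD
open Tr

/-- tree maps -/
structure TMap (T' T : Tr) where
  π : T'.V → T.V
  lvl_π : ∀ v, T.lvl (π v) = T'.lvl v
  par_π : ∀ v, π (T'.par v) = T.par (π v)

/-- `k`-coverings -/
structure Cov (k : ℕ) (T' T : Tr) extends TMap T' T where
  inj : ∀ v w, T'.lvl v ≤ k → π v = π w → v = w
  surj : ∀ v, T.lvl v ≤ k → ∃ w, π w = v
  φ : ℕ → T'.Strat → T.Strat
  φ_loc : ∀ b s s' n, (∀ v, T'.lvl v ≤ n → s.1 v = s'.1 v) →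
    ∀ v, T.lvl v ≤ n → (φ b s).1 v = (φ b s').1 v
  φ_id : ∀ b s v, T'.lvl v < k → (φ b s).1 (π v) = π (s.1 v)
  lift : ∀ b s x, b < 2 → T.IsRun x → T.Conform b (φ b s) x →
    ∃ x', T'.IsRun x' ∧ T'.Conform b s x' ∧ ∀ n, π (x' n) = x n

namespace TMap
def id (T : Tr) : TMap T T := ⟨fun v => v, fun _ => rfl, fun _ => rfl⟩
def comp {T'' T' T : Tr} (f : TMap T'' T') (g : TMap T' T) : TMap T'' T :=
  ⟨fun v => g.π (f.π v), fun v => by rw [g.lvl_π, f.lvl_π], fun v => by rw [f.par_π, g.par_π]⟩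

lemma run {T' T : Tr} (f : TMap T' T) {x} (hx : T'.IsRun x) : T.IsRun (fun n => f.π (x n)) :=
  fun n => ⟨by rw [f.lvl_π, (hx n).1], by rw [← f.par_π, (hx n).2]⟩

def pre {T' T : Tr} (f : TMap T' T) (A : Set (ℕ → T.V)) : Set (ℕ → T'.V) :=
  {x | (fun n => f.π (x n)) ∈ A}

lemma pre_op {T' T : Tr} (f : TMap T' T) {A : Set (ℕ → T.V)} (hA : T.Op A) :
    T'.Op (f.pre A) := by
  intro x hx hxA
  obtain ⟨n, hn⟩ := hA _ (f.run hx) hxA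
  exact ⟨n, fun y hy e => hn _ (f.run hy) (by simp only [e])⟩

lemma pre_clo {T' T : Tr} (f : TMap T' T) {A : Set (ℕ → T.V)} (hA : T.Clo A) :
    T'.Clo (f.pre A) := ⟨f.pre_op hA.1, f.pre_op hA.2⟩
end TMap

namespace Cov
def id (k : ℕ) (T : Tr) : Cov k T T where
  toTMap := TMap.id T
  inj _ _ _ h := h
  surj v _ := ⟨v, rfl⟩
  φ _ s := s
  φ_loc _ _ _ _ h := h
  φ_id _ _ _ _ := rfl
  lift _ _ x _ hx hc := ⟨x, hx, hc, fun _ => rfl⟩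

def comp {k : ℕ} {T'' T' T : Tr} (f : Cov k T'' T') (g : Cov k T' T) : Cov k T'' T where
  toTMap := f.toTMap.comp g.toTMap
  inj v w h e := f.inj v w h (g.inj _ _ (by rw [f.lvl_π]; exact h) e)
  surj v h := by
    obtain ⟨w, rfl⟩ := g.surj v h
    obtain ⟨u, rfl⟩ := f.surj w (by rwa [g.lvl_π] at h)
    exact ⟨u, rfl⟩
  φ b s := g.φ b (f.φ b s)
  φ_loc b s s' n h := g.φ_loc b _ _ n (f.φ_loc b s s' n h)
  φ_id b s v h := by
    change (g.φ b (f.φ b s)).1 (g.π (f.π v)) = g.π (f.π (s.1 v))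
    rw [g.φ_id _ _ _ (by rwa [f.lvl_π]), f.φ_id _ _ _ h]
  lift b s x hb hx hc := by
    obtain ⟨x', h1, h2, h3⟩ := g.lift b _ x hb hx hc
    obtain ⟨x'', h4, h5, h6⟩ := f.lift b _ x' hb h1 h2
    exact ⟨x'', h4, h5, fun n => by rw [← h3, ← h6]; rfl⟩

def mono {k k' : ℕ} {T' T : Tr} (h : k ≤ k') (f : Cov k' T' T) : Cov k T' T where
  toTMap := f.toTMap
  inj v w hv e := f.inj v w (hv.trans h) e
  surj v hv := f.surj v (hv.trans h)
  φ := f.φ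
  φ_loc := f.φ_loc
  φ_id b s v hv := f.φ_id b s v (hv.trans_le h)
  lift := f.lift
end Cov

lemma exists_thread (N : ℕ) : ∀ (X : ℕ → Type) (p : ∀ n, X (n+1) → X n) (Q : ∀ n, X n → Prop)
    (_ : ∀ n, N ≤ n → ∀ v, Q n v → ∃ w, Q (n+1) w ∧ p n w = v) (v : X N) (_ : Q N v),
    ∃ u : ∀ n, X n, (∀ n, p n (u (n+1)) = u n) ∧ u N = v := by
  induction N with
  | zero =>
    intro X p Q hs v hv
    choose g hg1 hg2 using hs
    let u : ∀ n, {a : X n // Q n a} := fun n =>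
      Nat.rec ⟨v, hv⟩ (fun n a => ⟨g n (Nat.zero_le n) a.1 a.2, hg1 n _ _ _⟩) n
    exact ⟨fun n => (u n).1, fun n => hg2 n (Nat.zero_le n) _ (u n).2, rfl⟩
  | succ N ih =>
    intro X p Q hs v hv
    obtain ⟨u, h1, h2⟩ := ih (fun n => X (n+1)) (fun n => p (n+1)) (fun n => Q (n+1))
      (fun n hn => hs (n+1) (by omega)) v hv
    let u' : ∀ n, X n := fun n => match n with
      | 0 => p 0 (u 0)
      | n+1 => u n
    refine ⟨u', fun n => ?_, h2⟩
    cases n with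
    | zero => rfl
    | succ n => exact h1 n

section limit
variable {k : ℕ} {T : ℕ → Tr} (c : ∀ n, Cov (k+n) (T (n+1)) (T n))

def LV := {v : ∀ n, (T n).V // ∀ n, (c n).π (v (n+1)) = v n}

variable {c}

lemma LV.lvl (v : LV c) (n : ℕ) : (T n).lvl (v.1 n) = (T 0).lvl (v.1 0) := by
  induction n with
  | zero => rfl
  | succ n ih => rw [← ih, ← v.2 n, (c n).lvl_π]

lemma LV.ext' {v w : LV c} (n : ℕ) (h : (T n).lvl (v.1 n) ≤ k + n) (e : v.1 n = w.1 n) :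
    v = w := by
  have h1 : ∀ m, n ≤ m → v.1 m = w.1 m := by
    intro m hm
    induction m, hm using Nat.le_induction with
    | base => exact e
    | succ m hm ih =>
      refine (c m).inj _ _ ?_ (by rw [v.2, w.2, ih])
      rw [v.lvl]; rw [v.lvl] at h; omega
  have h2 : ∀ j m, v.1 (m + j) = w.1 (m + j) → v.1 m = w.1 m := by
    intro j
    induction j with
    | zero => exact fun m h => h
    | succ j ih => exact fun m h => ih m (by rw [← v.2, ← w.2]; exact congrArg _ h)
  exact Subtype.ext (funext fun m => h2 n m (h1 _ (by omega)))

lemma LV.exists (n : ℕ) (v : (T n).V) (h : (T n).lvl v ≤ k + n) : ∃ w : LV c, w.1 n = v := by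
  obtain ⟨u, h1, h2⟩ := exists_thread n (fun n => (T n).V) (fun n => (c n).π)
    (fun m w => (T m).lvl w = (T n).lvl v) (fun m hm w hw => by
      obtain ⟨w', rfl⟩ := (c m).surj w (by omega)
      exact ⟨w', by rw [← hw, (c m).lvl_π], rfl⟩) v rfl
  exact ⟨⟨u, h1⟩, h2⟩

variable (c)

/-- the inverse limit tree -/
def LT : Tr where
  V := LV c
  lvl v := (T 0).lvl (v.1 0)
  par v := ⟨fun n => (T n).par (v.1 n), fun n => by rw [(c n).par_π, v.2]⟩
  lvl_par v := (T 0).lvl_par _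
  ex_child v := by
    let n := (T 0).lvl (v.1 0) + 1
    obtain ⟨w, hw1, hw2⟩ := (T n).ex_child (v.1 n)
    obtain ⟨w', rfl⟩ := LV.exists (c := c) n w (by rw [hw1, v.lvl]; omega)
    refine ⟨w', by rw [← w'.lvl n, hw1, v.lvl], ?_⟩
    refine LV.ext' n ?_ hw2
    change (T n).lvl ((T n).par (w'.1 n)) ≤ _
    rw [(T n).lvl_par, hw1, v.lvl]; omega

noncomputable def lft (n : ℕ) (v : (T n).V) (h : (T n).lvl v ≤ k + n) : LV c :=
  (LV.exists n v h).choose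

variable {c}

lemma lft_spec (n : ℕ) (v : (T n).V) (h : (T n).lvl v ≤ k + n) : (lft c n v h).1 n = v :=
  (LV.exists (c := c) n v h).choose_spec

lemma lft_eq {n : ℕ} {v : (T n).V} {h : (T n).lvl v ≤ k + n} {w : LV c} (e : w.1 n = v) :
    lft c n v h = w :=
  LV.ext' n (by rw [lft_spec]; exact h) (by rw [lft_spec, e])

/-- restriction of a strategy on the limit to the tree `T n` -/
noncomputable def sg (s : (LT c).Strat) (n : ℕ) : (T n).Strat :=
  ⟨fun v => if h : (T n).lvl v < k + n then (s.1 (lft c n v h.le)).1 n else (T n).child v, by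
    intro v
    beta_reduce
    split_ifs with h
    · have h1 := s.2 (lft c n v h.le)
      constructor
      · have := h1.1
        change (T 0).lvl ((s.1 (lft c n v h.le)).1 0) = (T 0).lvl ((lft c n v h.le).1 0) + 1 at this
        have e1 := LV.lvl (s.1 (lft c n v h.le)) n
        have e2 := LV.lvl (lft c n v h.le) n
        rw [lft_spec] at e2
        exact e1.trans (this.trans (congrArg (· + 1) e2.symm))
      · have := congrArg (fun u : LV c => u.1 n) h1.2
        change (T n).par _ = _ at this
        rw [this, lft_spec]
    · exact (T n).child_spec v⟩

lemma sg_val (s : (LT c).Strat) (n : ℕ) {v : LV c} (h : (T 0).lvl (v.1 0) < k + n) :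
    (sg s n).1 (v.1 n) = (s.1 v).1 n := by
  have h' : (T n).lvl (v.1 n) < k + n := by rwa [v.lvl]
  simp only [sg, dif_pos h']
  rw [lft_eq rfl]

noncomputable def fl (b : ℕ) (s : (LT c).Strat) : ℕ → ∀ n, (T n).Strat
  | 0, n => sg s n
  | j+1, n => (c n).φ b (fl b s j (n+1))

lemma fl_succ (b : ℕ) (s : (LT c).Strat) (j : ℕ) : ∀ n (v : (T n).V), (T n).lvl v < k + n + j →
    (fl b s (j+1) n).1 v = (fl b s j n).1 v := by
  induction j with
  | zero =>
    intro n v h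
    obtain ⟨w, rfl⟩ := LV.exists (c := c) n v (by omega)
    rw [w.lvl] at h
    change ((c n).φ b (sg s (n+1))).1 (w.1 n) = (sg s n).1 (w.1 n)
    conv_lhs => rw [← w.2 n]
    rw [(c n).φ_id _ _ _ (by rw [w.lvl]; omega), sg_val s n (by omega), sg_val s (n+1) (by omega),
      (s.1 w).2]
  | succ j ih =>
    intro n v h
    exact (c n).φ_loc b _ _ ((T n).lvl v) (fun w hw => ih (n+1) w (by omega)) v le_rfl

noncomputable def tau (b : ℕ) (s : (LT c).Strat) (n : ℕ) : (T n).Strat :=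
  ⟨fun v => (fl b s ((T n).lvl v + 1) n).1 v, fun v => (fl b s ((T n).lvl v + 1) n).2 v⟩

lemma fl_const (b : ℕ) (s : (LT c).Strat) (n : ℕ) (v : (T n).V) {j i : ℕ} (hij : j ≤ i)
    (h : (T n).lvl v < k + n + j) : (fl b s i n).1 v = (fl b s j n).1 v := by
  induction i, hij using Nat.le_induction with
  | base => rfl
  | succ i hi ih => rw [fl_succ b s i n v (by omega), ih]

lemma tau_eq (b : ℕ) (s : (LT c).Strat) (n : ℕ) (v : (T n).V) (j : ℕ)
    (h : (T n).lvl v < k + n + j) : (tau b s n).1 v = (fl b s j n).1 v := by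
  rw [← fl_const b s n v (le_max_left j ((T n).lvl v + 1)) h]
  exact (fl_const b s n v (le_max_right j ((T n).lvl v + 1)) (by omega)).symm

lemma tau_succ (b : ℕ) (s : (LT c).Strat) (n : ℕ) :
    tau b s n = (c n).φ b (tau b s (n+1)) := by
  refine Subtype.ext (funext fun v => ?_)
  rw [tau_eq b s n v ((T n).lvl v + 1 + 1) (by omega)]
  exact (c n).φ_loc b _ _ ((T n).lvl v)
    (fun w hw => (tau_eq b s (n+1) w _ (by omega)).symm) v le_rfl

lemma fl_loc (b : ℕ) (s s' : (LT c).Strat) (N : ℕ)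
    (h : ∀ v : LV c, (T 0).lvl (v.1 0) ≤ N → s.1 v = s'.1 v) (j : ℕ) :
    ∀ n (v : (T n).V), (T n).lvl v ≤ N → (fl b s j n).1 v = (fl b s' j n).1 v := by
  induction j with
  | zero =>
    intro n v hv
    change (sg s n).1 v = (sg s' n).1 v
    simp only [sg]
    split_ifs with h'
    · rw [h]
      rwa [← LV.lvl _ n, lft_spec]
    · rfl
  | succ j ih =>
    intro n v hv
    exact (c n).φ_loc b _ _ N (ih (n+1)) v hv

variable (c)

noncomputable def limCov : Cov k (LT c) (T 0) where
  π v := v.1 0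
  lvl_π v := rfl
  par_π v := rfl
  inj v w h e := LV.ext' 0 h e
  surj v h := LV.exists 0 v h
  φ b s := tau b s 0
  φ_loc b s s' n h v hv := fl_loc b s s' n h _ 0 v hv
  φ_id b s v h := by
    rw [tau_eq b s 0 _ 0 h]
    exact sg_val s 0 h
  lift b s x hb hx hc := by
    have hstep : ∀ n (x : {x // (T n).IsRun x ∧ (T n).Conform b (tau b s n) x}),
        ∃ y : {x // (T (n+1)).IsRun x ∧ (T (n+1)).Conform b (tau b s (n+1)) x},
          ∀ m, (c n).π (y.1 m) = x.1 m := by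
      rintro n ⟨x, h1, h2⟩
      rw [tau_succ] at h2
      obtain ⟨y, h3, h4, h5⟩ := (c n).lift b _ x hb h1 h2
      exact ⟨⟨y, h3, h4⟩, h5⟩
    choose g hg using hstep
    let X : ∀ n, {x // (T n).IsRun x ∧ (T n).Conform b (tau b s n) x} := fun n =>
      Nat.rec ⟨x, hx, hc⟩ g n
    have hX : ∀ n m, (c n).π ((X (n+1)).1 m) = (X n).1 m := fun n => hg n (X n)
    let y : ℕ → (LT c).V := fun j => ⟨fun n => (X n).1 j, fun n => hX n j⟩
    refine ⟨y, fun n => ⟨((X 0).2.1 n).1, Subtype.ext (funext fun m => ((X m).2.1 n).2)⟩, ?_,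
      fun n => rfl⟩
    intro j hj
    have hl : (T 0).lvl ((y j).1 0) = j := ((X 0).2.1 j).1
    refine LV.ext' (j+1) ?_ ?_
    · change (T (j+1)).lvl ((X (j+1)).1 (j+1)) ≤ _
      rw [((X (j+1)).2.1 (j+1)).1]; omega
    · have h4 := sg_val s (j+1) (v := y j) (by rw [hl]; omega)
      refine Eq.trans ?_ h4
      change (X (j+1)).1 (j+1) = (sg s (j+1)).1 ((X (j+1)).1 j)
      rw [(X (j+1)).2.2 j hj, tau_eq b s (j+1) _ 0]
      · rfl
      · rw [((X (j+1)).2.1 j).1]; omega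

def limProj (n : ℕ) : TMap (LT c) (T n) where
  π v := v.1 n
  lvl_π v := LV.lvl v n
  par_π v := rfl

end limit
end BD

open scoped ENNReal NNReal Classical

namespace BD
open Tr

inductive Tag (V : Type) : Type
  | none : Tag V
  | one (S : Set V) : Tag V
  | exit (S : Set V) (u : V) : Tag V
  | stay (S : Set V) : Tag V

def Tag.S {V : Type} : Tag V → Set V
  | .none => ∅
  | .one S => S
  | .exit S _ => S
  | .stay S => S

section unravel
variable (T : Tr) (K : ℕ) (TA : T.V → Prop)

/-- quasi-strategies for the player of even parity, at `q` -/
def QS (S : Set T.V) (q : T.V) : Prop :=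
  q ∈ S ∧ (∀ v ∈ S, T.lvl v % 2 = 0 → ∃ w, T.Ch v w ∧ w ∈ S) ∧
    (∀ v ∈ S, T.lvl v % 2 = 1 → ∀ w, T.Ch v w → w ∈ S)

/-- the first player can force to leave `TA` -/
def Fi (S : Set T.V) (v : T.V) : Prop := F 0 S {v | ¬ TA v} v

def legal (v : T.V) : Tag T.V → Prop
  | .none => T.lvl v ≤ K
  | .one S => T.lvl v = K + 1 ∧ QS T S v
  | .exit S u => K + 2 ≤ T.lvl v ∧ QS T S (T.anc v (K+1)) ∧ u ∈ S ∧ ¬ TA u ∧ K + 2 ≤ T.lvl u ∧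
      (T.lvl v ≤ T.lvl u → T.anc u (T.lvl v) = v) ∧ (T.lvl u ≤ T.lvl v → T.anc v (T.lvl u) = u)
  | .stay S => K + 2 ≤ T.lvl v ∧ QS T S (T.anc v (K+1)) ∧
      ∀ n, K + 2 ≤ n → n ≤ T.lvl v → T.anc v n ∈ S ∧ ¬ Fi T TA S (T.anc v n)

/-- the tag at a level -/
def trunc {V : Type} (m : ℕ) (t : Tag V) : Tag V :=
  if m ≤ K then .none else if m = K + 1 then .one t.S else t

variable {T K TA}

lemma legal_none_iff {v : T.V} {t : Tag T.V} (h : legal T K TA v t) (hl : T.lvl v ≤ K) :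
    t = .none := by
  cases t <;> simp only [legal] at h <;> first | rfl | omega

lemma legal_one_iff {v : T.V} {t : Tag T.V} (h : legal T K TA v t) (hl : T.lvl v = K + 1) :
    t = .one t.S ∧ QS T t.S v := by
  cases t <;> simp only [legal] at h <;> first | exact ⟨rfl, h.2⟩ | omega

lemma legal_ge {v : T.V} {t : Tag T.V} (h : legal T K TA v t) (hl : K + 2 ≤ T.lvl v) :
    (t = .stay t.S ∨ ∃ u, t = .exit t.S u) ∧ QS T t.S (T.anc v (K+1)) := by
  cases t <;> simp only [legal] at h
  · omega
  · omega
  · exact ⟨Or.inr ⟨_, rfl⟩, h.2.1⟩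
  · exact ⟨Or.inl rfl, h.2.1⟩

lemma legal_par {v : T.V} {t : Tag T.V} (h : legal T K TA v t) :
    legal T K TA (T.par v) (trunc K (T.lvl v - 1) t) := by
  have hlp := T.lvl_par v
  unfold trunc
  split_ifs with h1 h2
  · simp only [legal]; omega
  · have := (legal_ge h (by omega)).2
    have e : T.anc v (K+1) = T.par v := by
      rw [← anc_par (by omega), anc_of_lvl (by omega)]
    rw [e] at this
    exact ⟨by omega, this⟩
  · have hq : T.anc (T.par v) (K+1) = T.anc v (K+1) := anc_par (by omega)
    cases t with
    | none => simp only [legal] at h; omega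
    | one S => simp only [legal] at h; omega
    | exit S u =>
      obtain ⟨a1, a2, a3, a4, a5, a6, a7⟩ := h
      refine ⟨by omega, by rwa [hq], a3, a4, a5, fun hle => ?_, fun hle => ?_⟩
      · rw [hlp] at hle ⊢
        rcases Nat.lt_or_ge (T.lvl u) (T.lvl v) with h3 | h3
        · have := a7 h3.le
          have e : T.lvl u = T.lvl v - 1 := by omega
          rw [← e, anc_self, ← this, ← anc_par h3]
          exact anc_of_lvl (by omega)
        · have e := a6 h3
          rw [← anc_anc (n := T.lvl v) (by omega) h3, e, ← anc_par (by omega)]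
          exact anc_of_lvl (by omega)
      · rw [anc_par (by omega)]; exact a7 (by omega)
    | stay S =>
      obtain ⟨a1, a2, a3⟩ := h
      refine ⟨by omega, by rwa [hq], fun n h3 h4 => ?_⟩
      rw [anc_par (by omega)]
      exact a3 n h3 (by omega)

lemma exists_exit {S : Set T.V} {q : T.V} (hS : QS T S q) {v : T.V} (hF : Fi T TA S v)
    (hv : v ∈ S) : ∃ u ∈ S, ¬ TA u ∧ T.lvl v ≤ T.lvl u ∧ T.anc u (T.lvl v) = v := by
  obtain ⟨α, hα⟩ := hF
  induction hα with
  | base h => exact ⟨_, hv, h, le_rfl, anc_self _⟩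
  | mine hb hc hs _ _ ih =>
    obtain ⟨u, h1, h2, h3, h4⟩ := ih hs
    have := hc.1
    refine ⟨u, h1, h2, by omega, ?_⟩
    rw [← anc_anc (n := T.lvl _) (by omega) h3, h4, anc_child hc le_rfl, anc_self]
  | @theirs α v' f hb _ _ ih =>
    have hc := T.child_spec v'
    have hs := hS.2.2 _ hv (by omega) _ hc
    obtain ⟨u, h1, h2, h3, h4⟩ := ih _ hc hs hs
    have := hc.1
    refine ⟨u, h1, h2, by omega, ?_⟩
    rw [← anc_anc (n := T.lvl _) (by omega) h3, h4, anc_child hc le_rfl, anc_self]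

lemma stay_child {S : Set T.V} {v w : T.V} (h : legal T K TA v (.stay S)) (hc : T.Ch v w)
    (hs : w ∈ S) (hF : ¬ Fi T TA S w) : legal T K TA w (.stay S) := by
  obtain ⟨a1, a2, a3⟩ := h
  have := hc.1
  refine ⟨by omega, by rwa [anc_child hc (by omega)], fun n h3 h4 => ?_⟩
  rcases Nat.lt_or_ge (T.lvl v) n with h5 | h5
  · rw [anc_of_lvl (by omega)]; exact ⟨hs, hF⟩
  · rw [anc_child hc h5]; exact a3 n h3 h5

lemma stay_first {S : Set T.V} {q w : T.V} (hl : T.lvl q = K + 1) (h : QS T S q) (hc : T.Ch q w)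
    (hs : w ∈ S) (hF : ¬ Fi T TA S w) : legal T K TA w (.stay S) := by
  have := hc.1
  refine ⟨by omega, by rwa [anc_child hc (by omega), anc_of_lvl hl], fun n h3 h4 => ?_⟩
  rw [anc_of_lvl (by omega)]; exact ⟨hs, hF⟩

lemma exit_first {S : Set T.V} {q w u : T.V} (hl : T.lvl q = K + 1) (h : QS T S q) (hc : T.Ch q w)
    (hu : u ∈ S) (hF : ¬ TA u) (hlu : T.lvl w ≤ T.lvl u) (e : T.anc u (T.lvl w) = w) :
    legal T K TA w (.exit S u) := by
  have := hc.1
  refine ⟨by omega, by rwa [anc_child hc (by omega), anc_of_lvl hl], hu, hF, by omega,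
    fun _ => e, fun h => ?_⟩
  have e2 : T.lvl u = T.lvl w := by omega
  rw [e2, anc_self, ← e, ← e2, anc_self]

lemma legal_child (hK : K % 2 = 0) {v : T.V} {t : Tag T.V} (h : legal T K TA v t) :
    ∃ w t', T.Ch v w ∧ legal T K TA w t' ∧ trunc K (T.lvl v) t' = t := by
  cases t with
  | none =>
    have h1 : T.lvl v ≤ K := h
    have hc := T.child_spec v
    by_cases h2 : T.lvl v = K
    · refine ⟨T.child v, .one Set.univ, hc, ⟨by rw [hc.1, h2], trivial, fun w _ _ =>
        ⟨T.child w, T.child_spec w, trivial⟩, fun _ _ _ _ _ => trivial⟩, ?_⟩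
      simp [trunc, h1]
    · refine ⟨T.child v, .none, hc, ?_, by simp [trunc, h1]⟩
      simp only [legal]; rw [hc.1]; omega
  | one S =>
    obtain ⟨h1, h2⟩ := h
    have hc := T.child_spec v
    have hs := h2.2.2 v h2.1 (by omega) _ hc
    by_cases hF : Fi T TA S (T.child v)
    · obtain ⟨u, b1, b2, b3, b4⟩ := exists_exit h2 hF hs
      exact ⟨_, .exit S u, hc, exit_first h1 h2 hc b1 b2 b3 b4, by simp [trunc, h1, Tag.S]⟩
    · exact ⟨_, .stay S, hc, stay_first h1 h2 hc hs hF, by simp [trunc, h1, Tag.S]⟩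
  | exit S u =>
    have h0 := h
    obtain ⟨a1, a2, a3, a4, a5, a6, a7⟩ := h
    have ht : ∀ t' : Tag T.V, trunc K (T.lvl v) t' = t' := fun t' => by
      unfold trunc; rw [if_neg (by omega), if_neg (by omega)]
    by_cases hlt : T.lvl v < T.lvl u
    · have hl : T.lvl (T.anc u (T.lvl v + 1)) = T.lvl v + 1 := lvl_anc (by omega)
      have hc : T.Ch v (T.anc u (T.lvl v + 1)) :=
        ⟨hl, by rw [par_anc (by omega), a6 hlt.le]⟩
      refine ⟨_, .exit S u, hc, ⟨by omega, by rwa [anc_child hc (by omega)], a3, a4, a5, ?_, ?_⟩,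
        ht _⟩
      · intro _; rw [hl]
      · intro h5
        have : T.lvl u = T.lvl v + 1 := by omega
        rw [← this, anc_self, anc_self]
    · have hc := T.child_spec v
      have := hc.1
      refine ⟨_, .exit S u, hc, ⟨by omega, by rwa [anc_child hc (by omega)], a3, a4, a5, ?_, ?_⟩,
        ht _⟩
      · intro _; omega
      · intro h5
        rw [anc_child hc (by omega)]; exact a7 (by omega)
  | stay S =>
    have h0 := h
    obtain ⟨a1, a2, a3⟩ := h
    have ht : ∀ t' : Tag T.V, trunc K (T.lvl v) t' = t' := fun t' => by
      unfold trunc; rw [if_neg (by omega), if_neg (by omega)]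
    obtain ⟨hvS, hvF⟩ := a3 (T.lvl v) a1 le_rfl
    rw [anc_self] at hvS hvF
    by_cases hb : T.lvl v % 2 = 0
    · obtain ⟨w, hc, hs⟩ := a2.2.1 v hvS hb
      exact ⟨w, .stay S, hc, stay_child h0 hc hs fun hF => hvF (F_mine hb hc hs hF), ht _⟩
    · by_contra hcon
      refine hvF (F_theirs hb fun w hc hs => ?_)
      by_contra hF
      exact hcon ⟨w, .stay S, hc, stay_child h0 hc hs hF, ht _⟩

variable (T K TA)

/-- the auxiliary tree -/
def UT (hK : K % 2 = 0) : Tr where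
  V := {p : T.V × Tag T.V // legal T K TA p.1 p.2}
  lvl p := T.lvl p.1.1
  par p := ⟨(T.par p.1.1, trunc K (T.lvl p.1.1 - 1) p.1.2), legal_par p.2⟩
  lvl_par p := T.lvl_par _
  ex_child p := by
    obtain ⟨w, t, hc, hl, ht⟩ := legal_child hK p.2
    refine ⟨⟨(w, t), hl⟩, hc.1, Subtype.ext (Prod.ext hc.2 ?_)⟩
    change trunc K (T.lvl w - 1) t = _
    rw [hc.1]; exact ht

variable {T K TA} {hK : K % 2 = 0}

lemma UT_ch {p p' : (UT T K TA hK).V} (h : (UT T K TA hK).Ch p p') :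
    T.Ch p.1.1 p'.1.1 ∧ trunc K (T.lvl p.1.1) p'.1.2 = p.1.2 := by
  have h1 : T.lvl p'.1.1 = T.lvl p.1.1 + 1 := h.1
  have h2 := congrArg Subtype.val h.2
  have h3 : T.par p'.1.1 = p.1.1 := congrArg Prod.fst h2
  have h4 : trunc K (T.lvl p'.1.1 - 1) p'.1.2 = p.1.2 := congrArg Prod.snd h2
  rw [h1] at h4
  exact ⟨⟨h1, h3⟩, h4⟩

noncomputable def mv (s : (UT T K TA hK).Strat) (v : T.V) (t : Tag T.V) : T.V :=
  if h : legal T K TA v t then (s.1 ⟨(v, t), h⟩).1.1 else T.child v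

noncomputable def tg (s : (UT T K TA hK).Strat) (v : T.V) (t : Tag T.V) : Tag T.V :=
  if h : legal T K TA v t then (s.1 ⟨(v, t), h⟩).1.2 else .none

variable {s : (UT T K TA hK).Strat} {v : T.V} {t : Tag T.V}

lemma mv_ch : T.Ch v (mv s v t) := by
  unfold mv; split_ifs with h
  · exact (UT_ch (s.2 ⟨(v, t), h⟩)).1
  · exact T.child_spec v

lemma mv_legal (h : legal T K TA v t) : legal T K TA (mv s v t) (tg s v t) := by
  simp only [mv, tg, dif_pos h]; exact (s.1 ⟨(v, t), h⟩).2

lemma tg_trunc (h : legal T K TA v t) : trunc K (T.lvl v) (tg s v t) = t := by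
  simp only [tg, dif_pos h]; exact (UT_ch (s.2 ⟨(v, t), h⟩)).2

lemma mv_lvl : T.lvl (mv s v t) = T.lvl v + 1 := (mv_ch (s := s)).1

lemma tg_low (h : legal T K TA v t) (hl : T.lvl v < K) : tg s v t = .none :=
  legal_none_iff (mv_legal (s := s) h) (by rw [mv_lvl]; omega)

lemma tg_high (h : legal T K TA v t) (hl : K + 2 ≤ T.lvl v) : tg s v t = t := by
  have := tg_trunc (s := s) h
  unfold trunc at this
  rwa [if_neg (by omega), if_neg (by omega)] at this

lemma tg_K (h : legal T K TA v t) (hl : T.lvl v = K) :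
    tg s v t = .one (tg s v t).S ∧ QS T (tg s v t).S (mv s v t) :=
  legal_one_iff (mv_legal (s := s) h) (by rw [mv_lvl]; omega)

lemma tg_K1 {S : Set T.V} (h : legal T K TA v (.one S)) :
    tg s v (.one S) = .stay S ∨ ∃ u, tg s v (.one S) = .exit S u := by
  have hl : T.lvl v = K + 1 := h.1
  have h1 := (legal_ge (mv_legal (s := s) h) (by rw [mv_lvl]; omega)).1
  have h2 := tg_trunc (s := s) h
  unfold trunc at h2
  rw [if_neg (by omega), if_pos hl] at h2
  have h3 : (tg s v (.one S)).S = S := by injection h2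
  rwa [h3] at h1

lemma mv_congr {s s' : (UT T K TA hK).Strat} {n : ℕ}
    (h : ∀ p : (UT T K TA hK).V, T.lvl p.1.1 ≤ n → s.1 p = s'.1 p) (hv : T.lvl v ≤ n) :
    mv s v t = mv s' v t ∧ tg s v t = tg s' v t := by
  unfold mv tg
  split_ifs with hl
  · have e := h ⟨(v, t), hl⟩ hv
    exact ⟨congrArg (fun p => p.1.1) e, congrArg (fun p => p.1.2) e⟩
  · exact ⟨rfl, rfl⟩

lemma build {x : ℕ → T.V} (hx : T.IsRun x) {S : Set T.V} {t : Tag T.V} (hS : t.S = S)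
    (hq : QS T S (x (K+1))) (hl : ∀ m, K + 2 ≤ m → legal T K TA (x m) t) {b : ℕ}
    (h1 : ∀ m < K, m % 2 = b → mv s (x m) .none = x (m+1))
    (h2 : K % 2 = b → mv s (x K) .none = x (K+1) ∧ tg s (x K) .none = .one S)
    (h3 : (K+1) % 2 = b → mv s (x (K+1)) (.one S) = x (K+2) ∧ tg s (x (K+1)) (.one S) = t)
    (h4 : ∀ m, K + 2 ≤ m → m % 2 = b → mv s (x m) t = x (m+1)) :
    ∃ x', (UT T K TA hK).IsRun x' ∧ (UT T K TA hK).Conform b s x' ∧ ∀ n, (x' n).1.1 = x n := by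
  have hleg : ∀ m, legal T K TA (x m) (trunc K m t) := by
    intro m
    unfold trunc
    split_ifs with a1 a2
    · simp only [legal]; rw [(hx m).1]; exact a1
    · subst a2; rw [hS]; exact ⟨(hx _).1, hq⟩
    · exact hl m (by omega)
  refine ⟨fun m => ⟨(x m, trunc K m t), hleg m⟩, fun n => ⟨(hx n).1, ?_⟩, ?_, fun _ => rfl⟩
  · refine Subtype.ext (Prod.ext (hx n).2 ?_)
    change trunc K (T.lvl (x (n+1)) - 1) (trunc K (n+1) t) = trunc K n t
    rw [(hx (n+1)).1]
    simp only [trunc, Nat.add_sub_cancel]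
    split_ifs with a1 a2 a3 a4 a5 <;> first | rfl | omega
  · intro n hn
    have key : ∀ t', trunc K n t = t' → mv s (x n) t' = x (n+1) → tg s (x n) t' = trunc K (n+1) t →
        (⟨(x (n+1), trunc K (n+1) t), hleg (n+1)⟩ : (UT T K TA hK).V) =
          s.1 ⟨(x n, trunc K n t), hleg n⟩ := by
      rintro _ rfl e1 e2
      simp only [mv, tg, dif_pos (hleg n)] at e1 e2
      exact Subtype.ext (Prod.ext e1.symm e2.symm)
    have hln := (hx n).1
    rcases Nat.lt_or_ge n K with a | a
    · have e : trunc K n t = .none := by unfold trunc; rw [if_pos (by omega)]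
      have e' : trunc K (n+1) t = .none := by unfold trunc; rw [if_pos (by omega)]
      refine key _ e (h1 n a hn) ?_
      rw [e', tg_low (e ▸ hleg n) (by omega)]
    rcases Nat.lt_or_ge K n with a' | a'
    · rcases Nat.lt_or_ge (K+1) n with a'' | a''
      · have e : trunc K n t = t := by unfold trunc; rw [if_neg (by omega), if_neg (by omega)]
        have e' : trunc K (n+1) t = t := by unfold trunc; rw [if_neg (by omega), if_neg (by omega)]
        refine key _ e (h4 n a'' hn) ?_
        rw [e', tg_high (e ▸ hleg n) (by omega)]
      · obtain rfl : n = K + 1 := by omega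
        have e : trunc K (K+1) t = .one S := by
          unfold trunc; rw [if_neg (by omega), if_pos rfl, hS]
        have e' : trunc K (K+1+1) t = t := by
          unfold trunc; rw [if_neg (by omega), if_neg (by omega)]
        refine key _ e (h3 hn).1 ?_
        rw [e', (h3 hn).2]
    · obtain rfl : n = K := by omega
      have e : trunc n n t = .none := by unfold trunc; rw [if_pos (by omega)]
      have e' : trunc n (n+1) t = .one S := by
        unfold trunc; rw [if_neg (by omega), if_pos rfl, hS]
      refine key _ e (h2 hn).1 ?_
      rw [e', (h2 hn).2]

lemma legal_exit_run {x : ℕ → T.V} (hx : T.IsRun x) {S : Set T.V} (hq : QS T S (x (K+1)))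
    {N : ℕ} (hN : K + 2 ≤ N) (hS : x N ∈ S) (hTA : ¬ TA (x N)) {m : ℕ} (hm : K + 2 ≤ m) :
    legal T K TA (x m) (.exit S (x N)) := by
  refine ⟨by rw [(hx m).1]; exact hm, by rwa [hx.anc (by omega)], hS, hTA,
    by rw [(hx N).1]; exact hN, ?_, ?_⟩ <;> rw [(hx m).1, (hx N).1] <;> intro h <;> exact hx.anc h

lemma exit_forced {x : ℕ → T.V} (hx : T.IsRun x) {S : Set T.V} {N m : ℕ}
    (h : legal T K TA (x m) (.exit S (x N))) (hmN : m < N) :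
    mv s (x m) (.exit S (x N)) = x (m+1) := by
  have h1 := mv_legal (s := s) h
  rw [tg_high h h.1] at h1
  have h2 := h1.2.2.2.2.2.1
  rw [mv_lvl, (hx m).1, (hx N).1] at h2
  rw [← h2 (by omega), hx.anc (by omega)]

lemma exit_forced_first {x : ℕ → T.V} (hx : T.IsRun x) {S : Set T.V} {N : ℕ} (hN : K + 2 ≤ N)
    (h : legal T K TA (x (K+1)) (.one S)) (e : tg s (x (K+1)) (.one S) = .exit S (x N)) :
    mv s (x (K+1)) (.one S) = x (K+2) := by
  have h1 := mv_legal (s := s) h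
  rw [e] at h1
  have h2 := h1.2.2.2.2.2.1
  rw [mv_lvl, (hx _).1, (hx N).1] at h2
  rw [← h2 (by omega), hx.anc (by omega)]

/-- first level at which `Q` holds -/
noncomputable def fst (K : ℕ) (Q : T.V → Prop) (v : T.V) : ℕ :=
  sInf {n | K + 2 ≤ n ∧ n ≤ T.lvl v ∧ Q (T.anc v n)}

lemma fst_run {x : ℕ → T.V} (hx : T.IsRun x) {Q : T.V → Prop} {N m : ℕ} (hN : K + 2 ≤ N)
    (hQ : Q (x N)) (hmin : ∀ n, K + 2 ≤ n → n < N → ¬ Q (x n)) (hm : N ≤ m) :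
    fst K Q (x m) = N := by
  have hmem : N ∈ {n | K + 2 ≤ n ∧ n ≤ T.lvl (x m) ∧ Q (T.anc (x m) n)} :=
    ⟨hN, by rw [(hx m).1]; exact hm, by rwa [hx.anc hm]⟩
  apply le_antisymm (Nat.sInf_le hmem)
  by_contra hlt
  push Not at hlt
  obtain ⟨h1, h2, h3⟩ := Nat.sInf_mem (⟨N, hmem⟩ : Set.Nonempty _)
  refine hmin _ h1 hlt ?_
  rwa [hx.anc (hlt.le.trans hm)] at h3

lemma ex_run {x : ℕ → T.V} (hx : T.IsRun x) {Q : T.V → Prop} {m : ℕ} :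
    (∃ n, K + 2 ≤ n ∧ n ≤ T.lvl (x m) ∧ Q (T.anc (x m) n)) ↔
      ∃ n, K + 2 ≤ n ∧ n ≤ m ∧ Q (x n) := by
  rw [(hx m).1]
  refine exists_congr fun n => and_congr_right fun _ => and_congr_right fun h => ?_
  rw [hx.anc h]

end unravel
end BD

open scoped ENNReal NNReal Classical

namespace BD
open Tr

section unravel2
variable {T : Tr} {K : ℕ} {TA : T.V → Prop} {hK : K % 2 = 0}

noncomputable def Sq (s : (UT T K TA hK).Strat) (q : T.V) : Set T.V := (tg s (T.par q) .none).S

noncomputable def phiI (s : (UT T K TA hK).Strat) (v : T.V) : T.V :=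
  if T.lvl v ≤ K then mv s v .none else
  if ∃ n, K + 2 ≤ n ∧ n ≤ T.lvl v ∧ ¬ TA (T.anc v n) then
    mv s v (.exit (Sq s (T.anc v (K+1))) (T.anc v (fst K (fun v => ¬ TA v) v)))
  else if legal T K TA v (.stay (Sq s (T.anc v (K+1)))) then
    mv s v (.stay (Sq s (T.anc v (K+1))))
  else fmove 0 (Sq s (T.anc v (K+1))) {v | ¬ TA v} v

lemma phiI_ch (s : (UT T K TA hK).Strat) (v : T.V) : T.Ch v (phiI s v) := by
  unfold phiI; split_ifs
  · exact mv_ch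
  · exact mv_ch
  · exact mv_ch
  · exact fmove_ch v

lemma phiI_loc {s s' : (UT T K TA hK).Strat} {n : ℕ}
    (h : ∀ p : (UT T K TA hK).V, T.lvl p.1.1 ≤ n → s.1 p = s'.1 p) {v : T.V} (hv : T.lvl v ≤ n) :
    phiI s v = phiI s' v := by
  unfold phiI
  by_cases h1 : T.lvl v ≤ K
  · rw [if_pos h1, if_pos h1]; exact (mv_congr h hv).1
  · rw [if_neg h1, if_neg h1]
    have e : Sq s (T.anc v (K+1)) = Sq s' (T.anc v (K+1)) := by
      unfold Sq
      rw [par_anc (by omega), (mv_congr h _).2]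
      rw [lvl_anc (by omega)]; omega
    rw [e]
    split_ifs
    · exact (mv_congr h hv).1
    · exact (mv_congr h hv).1
    · rfl

lemma liftI (s : (UT T K TA hK).Strat) {x : ℕ → T.V} (hx : T.IsRun x)
    (hc : ∀ n, n % 2 = 0 → x (n+1) = phiI s (x n)) :
    ∃ x', (UT T K TA hK).IsRun x' ∧ (UT T K TA hK).Conform 0 s x' ∧ ∀ n, (x' n).1.1 = x n := by
  set S := Sq s (x (K+1)) with hSd
  have hlow : ∀ m, m ≤ K → m % 2 = 0 → mv s (x m) .none = x (m+1) := by
    intro m hm h2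
    rw [hc m h2, phiI, if_pos (by rw [(hx m).1]; exact hm)]
  have hleg : legal T K TA (x K) .none := le_of_eq (hx K).1
  have hSe : S = (tg s (x K) .none).S := by rw [hSd, Sq, (hx K).2]
  have hK1 := tg_K (s := s) hleg (hx K).1
  rw [hlow K le_rfl hK, ← hSe] at hK1
  obtain ⟨hone, hq⟩ := hK1
  have hanc : ∀ m, K + 2 ≤ m → T.anc (x m) (K+1) = x (K+1) := fun m hm => hx.anc (by omega)
  have hhi : ∀ m, K + 2 ≤ m → ¬ T.lvl (x m) ≤ K := fun m hm => by rw [(hx m).1]; omega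
  have hodd : ∀ m, x m ∈ S → m % 2 = 1 → x (m+1) ∈ S := fun m hm h1 =>
    hq.2.2 _ hm (by rw [(hx m).1]; exact h1) _ (hx.ch m)
  have hTAe : ∀ m, (∀ n, K + 2 ≤ n → n ≤ m → TA (x n)) →
      ¬ ∃ n, K + 2 ≤ n ∧ n ≤ T.lvl (x m) ∧ ¬ TA (T.anc (x m) n) := by
    intro m hm he
    obtain ⟨n, h1, h2, h3⟩ := (ex_run (Q := fun v => ¬ TA v) hx).1 he
    exact h3 (hm n h1 h2)
  have hstayF : ∀ m, legal T K TA (x m) (.stay S) → x m ∈ S ∧ ¬ Fi T TA S (x m) := by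
    intro m hm
    have := hm.2.2 (T.lvl (x m)) hm.1 le_rfl
    rwa [anc_self] at this
  have hstep1 : ∀ m, K + 2 ≤ m → m % 2 = 0 → (∀ n, K + 2 ≤ n → n ≤ m → TA (x n)) →
      legal T K TA (x m) (.stay S) → mv s (x m) (.stay S) = x (m+1) := by
    intro m hm h2 hTA hl
    rw [hc m h2, phiI, if_neg (hhi m hm), if_neg (hTAe m hTA), hanc m hm, if_pos hl]
  have hstep2 : ∀ m, K + 2 ≤ m → m % 2 = 0 → (∀ n, K + 2 ≤ n → n ≤ m → TA (x n)) →
      ¬ legal T K TA (x m) (.stay S) → x (m+1) = fmove 0 S {v | ¬ TA v} (x m) := by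
    intro m hm h2 hTA hl
    rw [hc m h2, phiI, if_neg (hhi m hm), if_neg (hTAe m hTA), hanc m hm, if_neg hl]
  have hFstep : ∀ m, K + 2 ≤ m → (∀ n, K + 2 ≤ n → n ≤ m → TA (x n)) → x m ∈ S →
      Fi T TA S (x m) → x (m+1) ∈ S ∧ Fi T TA S (x (m+1)) ∧
        rk 0 S {v | ¬ TA v} (x (m+1)) < rk 0 S {v | ¬ TA v} (x m) := by
    intro m hm hTA hS hF
    have hU : x m ∉ {v | ¬ TA v} := fun h => h (hTA m hm le_rfl)
    rcases Nat.mod_two_eq_zero_or_one m with h2 | h2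
    · rw [hstep2 m hm h2 hTA fun h => (hstayF m h).2 hF]
      exact fmove_spec hF hU (by rw [(hx m).1]; exact h2)
    · have hS' := hodd m hS h2
      exact ⟨hS', F_theirs_step hF hU (by rw [(hx m).1]; omega) (hx.ch m) hS'⟩
  have inv : ∀ m, K + 2 ≤ m → (∀ n, K + 2 ≤ n → n < m → TA (x n)) →
      x m ∈ S ∧ (legal T K TA (x m) (.stay S) ∨ Fi T TA S (x m)) := by
    intro m hm
    induction m, hm using Nat.le_induction with
    | base =>
      intro _
      have hS' := hodd (K+1) hq.1 (by omega)
      refine ⟨hS', ?_⟩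
      by_cases hF : Fi T TA S (x (K+2))
      · exact Or.inr hF
      · exact Or.inl (stay_first (hx _).1 hq (hx.ch _) hS' hF)
    | succ m hm ih =>
      intro hTA
      have hTA' : ∀ n, K + 2 ≤ n → n ≤ m → TA (x n) := fun n h1 h2 => hTA n h1 (by omega)
      obtain ⟨hS, hor⟩ := ih fun n h1 h2 => hTA n h1 (by omega)
      by_cases hl : legal T K TA (x m) (.stay S)
      · rcases Nat.mod_two_eq_zero_or_one m with h2 | h2
        · have h3 := mv_legal (s := s) hl
          rw [tg_high hl hl.1, hstep1 m hm h2 hTA' hl] at h3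
          exact ⟨(hstayF _ h3).1, Or.inl h3⟩
        · have hS' := hodd m hS h2
          refine ⟨hS', ?_⟩
          by_cases hF : Fi T TA S (x (m+1))
          · exact Or.inr hF
          · exact Or.inl (stay_child hl (hx.ch _) hS' hF)
      · have := hFstep m hm hTA' hS (hor.resolve_left hl)
        exact ⟨this.1, Or.inr this.2.1⟩
  by_cases hex : ∃ N, K + 2 ≤ N ∧ ¬ TA (x N)
  · have hN := Nat.find_spec hex
    have hmin : ∀ n, K + 2 ≤ n → n < Nat.find hex → TA (x n) := fun n h1 h2 => by
      by_contra h3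
      exact Nat.find_min hex h2 ⟨h1, h3⟩
    generalize Nat.find hex = N at hN hmin
    have hNS := (inv N hN.1 hmin).1
    have hL : ∀ m, K + 2 ≤ m → legal T K TA (x m) (.exit S (x N)) :=
      fun m hm => legal_exit_run hx hq hN.1 hNS hN.2 hm
    refine build hx (t := .exit S (x N)) (S := S) rfl hq hL (fun m hm => hlow m hm.le)
      (fun _ => ⟨hlow K le_rfl hK, hone⟩) (fun h => by omega) fun m hm h2 => ?_
    rcases Nat.lt_or_ge m N with h3 | h3
    · exact exit_forced hx (hL m hm) h3
    · rw [hc m h2, phiI, if_neg (hhi m hm), if_pos, hanc m hm,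
        fst_run hx hN.1 (Q := fun v => ¬ TA v) hN.2 (fun n h4 h5 => not_not.2 (hmin n h4 h5)) h3,
        hx.anc h3]
      exact (ex_run (Q := fun v => ¬ TA v) hx).2 ⟨N, hN.1, h3, hN.2⟩
  · push Not at hex
    have hL : ∀ m, K + 2 ≤ m → legal T K TA (x m) (.stay S) := by
      intro m hm
      refine (inv m hm fun n h1 _ => hex n h1).2.resolve_right fun hF => ?_
      have hS : ∀ n, K + 2 ≤ n → x n ∈ S := fun n hn => (inv n hn fun n h1 _ => hex n h1).1
      exact no_descent (b := 0) (S := S) (U := {v | ¬ TA v}) x m hF fun n hn hFn =>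
        (hFstep n (by omega) (fun n h1 _ => hex n h1) (hS n (by omega)) hFn).2
    exact build hx (t := .stay S) (S := S) rfl hq hL (fun m hm => hlow m hm.le)
      (fun _ => ⟨hlow K le_rfl hK, hone⟩) (fun h => by omega)
      fun m hm h2 => hstep1 m hm h2 (fun n h1 _ => hex n h1) (hL m hm)

/-! player II -/

def UU (s : (UT T K TA hK).Strat) (q : T.V) : Set T.V :=
  {u | ∃ S, legal T K TA q (.one S) ∧ tg s q (.one S) = .exit S u}

noncomputable def SU (s : (UT T K TA hK).Strat) (q u : T.V) : Set T.V :=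
  if h : ∃ S, legal T K TA q (.one S) ∧ tg s q (.one S) = .exit S u then h.choose else ∅

lemma SU_spec {s : (UT T K TA hK).Strat} {q u : T.V} (h : u ∈ UU s q) :
    legal T K TA q (.one (SU s q u)) ∧ tg s q (.one (SU s q u)) = .exit (SU s q u) u := by
  have h' : ∃ S, legal T K TA q (.one S) ∧ tg s q (.one S) = .exit S u := h
  unfold SU; rw [dif_pos h']; exact h'.choose_spec

def S0 (s : (UT T K TA hK).Strat) (q : T.V) : Set T.V := {w | ¬ F 1 Set.univ (UU s q) w}

noncomputable def phiII (s : (UT T K TA hK).Strat) (v : T.V) : T.V :=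
  if T.lvl v ≤ K then mv s v .none else
  if ∃ n, K + 2 ≤ n ∧ n ≤ T.lvl v ∧ T.anc v n ∈ UU s (T.anc v (K+1)) then
    mv s v (.exit (SU s (T.anc v (K+1)) (T.anc v (fst K (fun w => w ∈ UU s (T.anc v (K+1))) v)))
      (T.anc v (fst K (fun w => w ∈ UU s (T.anc v (K+1))) v)))
  else if legal T K TA v (.one (S0 s (T.anc v (K+1)))) then
    mv s v (.one (S0 s (T.anc v (K+1))))
  else if legal T K TA v (.stay (S0 s (T.anc v (K+1)))) then
    mv s v (.stay (S0 s (T.anc v (K+1))))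
  else fmove 1 Set.univ (UU s (T.anc v (K+1))) v

lemma phiII_ch (s : (UT T K TA hK).Strat) (v : T.V) : T.Ch v (phiII s v) := by
  unfold phiII; split_ifs
  · exact mv_ch
  · exact mv_ch
  · exact mv_ch
  · exact mv_ch
  · exact fmove_ch v

lemma phiII_loc {s s' : (UT T K TA hK).Strat} {n : ℕ}
    (h : ∀ p : (UT T K TA hK).V, T.lvl p.1.1 ≤ n → s.1 p = s'.1 p) {v : T.V} (hv : T.lvl v ≤ n) :
    phiII s v = phiII s' v := by
  unfold phiII
  by_cases h1 : T.lvl v ≤ K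
  · rw [if_pos h1, if_pos h1]; exact (mv_congr h hv).1
  · rw [if_neg h1, if_neg h1]
    have ht : ∀ t, tg s (T.anc v (K+1)) t = tg s' (T.anc v (K+1)) t := fun t => by
      refine (mv_congr h ?_).2
      rw [lvl_anc (by omega)]; omega
    have e : UU s (T.anc v (K+1)) = UU s' (T.anc v (K+1)) := by
      simp only [UU, ht]
    have e2 : ∀ u, SU s (T.anc v (K+1)) u = SU s' (T.anc v (K+1)) u := fun u => by
      simp only [SU, ht]
    have e3 : S0 s (T.anc v (K+1)) = S0 s' (T.anc v (K+1)) := by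
      simp only [S0, e]
    rw [e3, e, e2]
    split_ifs
    · exact (mv_congr h hv).1
    · exact (mv_congr h hv).1
    · exact (mv_congr h hv).1
    · rfl

lemma liftII (s : (UT T K TA hK).Strat) {x : ℕ → T.V} (hx : T.IsRun x)
    (hc : ∀ n, n % 2 = 1 → x (n+1) = phiII s (x n)) :
    ∃ x', (UT T K TA hK).IsRun x' ∧ (UT T K TA hK).Conform 1 s x' ∧ ∀ n, (x' n).1.1 = x n := by
  have hlow : ∀ m, m ≤ K → m % 2 = 1 → mv s (x m) .none = x (m+1) := by
    intro m hm h2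
    rw [hc m h2, phiII, if_pos (by rw [(hx m).1]; exact hm)]
  have hanc : ∀ m, K + 1 ≤ m → T.anc (x m) (K+1) = x (K+1) := fun m hm => hx.anc hm
  have hhi : ∀ m, K + 1 ≤ m → ¬ T.lvl (x m) ≤ K := fun m hm => by rw [(hx m).1]; omega
  have hUleg : ∀ u S, legal T K TA (x (K+1)) (.one S) → tg s (x (K+1)) (.one S) = .exit S u →
      u ∈ S ∧ ¬ TA u ∧ K + 2 ≤ T.lvl u := by
    intro u S h1 h2
    have h3 := mv_legal (s := s) h1
    rw [h2] at h3
    exact ⟨h3.2.2.1, h3.2.2.2.1, h3.2.2.2.2.1⟩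
  by_cases hex : ∃ N, K + 2 ≤ N ∧ x N ∈ UU s (x (K+1))
  · have hN := Nat.find_spec hex
    have hmin : ∀ n, K + 2 ≤ n → n < Nat.find hex → x n ∉ UU s (x (K+1)) := fun n h1 h2 h3 =>
      Nat.find_min hex h2 ⟨h1, h3⟩
    generalize Nat.find hex = N at hN hmin
    obtain ⟨h1, h2⟩ := SU_spec hN.2
    obtain ⟨h3, h4, h5⟩ := hUleg _ _ h1 h2
    have hL : ∀ m, K + 2 ≤ m → legal T K TA (x m) (.exit (SU s (x (K+1)) (x N)) (x N)) :=
      fun m hm => legal_exit_run hx h1.2 hN.1 h3 h4 hm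
    refine build hx (t := .exit (SU s (x (K+1)) (x N)) (x N)) rfl h1.2 hL (fun m hm => hlow m hm.le)
      (fun h => by omega) (fun _ => ⟨exit_forced_first hx hN.1 h1 h2, h2⟩) fun m hm hm2 => ?_
    rcases Nat.lt_or_ge m N with h6 | h6
    · exact exit_forced hx (hL m hm) h6
    · rw [hc m hm2, phiII, if_neg (hhi m (by omega)), hanc m (by omega), if_pos,
        fst_run hx hN.1 (Q := fun w => w ∈ UU s (x (K+1))) hN.2 hmin h6, hx.anc h6]
      exact (ex_run (Q := fun w => w ∈ UU s (x (K+1))) hx).2 ⟨N, hN.1, h6, hN.2⟩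
  · push Not at hex
    set q := x (K+1) with hqd
    have hexe : ∀ m, ¬ ∃ n, K + 2 ≤ n ∧ n ≤ T.lvl (x m) ∧ T.anc (x m) n ∈ UU s q := by
      intro m he
      obtain ⟨n, h1, h2, h3⟩ := (ex_run (Q := fun w => w ∈ UU s q) hx).1 he
      exact hex n h1 h3
    have hnU : ∀ m, K + 1 ≤ m → x m ∉ UU s q := by
      intro m hm hU
      obtain ⟨S, h1, h2⟩ := hU
      have h3 := (hUleg _ _ h1 h2).2.2
      rw [(hx m).1] at h3
      exact hex m h3 ⟨S, h1, h2⟩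
    have hstayS : ∀ m, legal T K TA (x m) (.stay (S0 s q)) → x m ∈ S0 s q ∧
        ¬ Fi T TA (S0 s q) (x m) := by
      intro m hm
      have := hm.2.2 (T.lvl (x m)) hm.1 le_rfl
      rwa [anc_self] at this
    have hS0 : ∀ m, K + 1 ≤ m → x m ∈ S0 s q := by
      intro m hm hF
      refine no_descent (b := 1) (S := Set.univ) (U := UU s q) x m hF fun n hn hFn => ?_
      have hn' : K + 1 ≤ n := by omega
      rcases Nat.mod_two_eq_zero_or_one n with h2 | h2
      · exact F_theirs_step hFn (hnU n hn') (by rw [(hx n).1]; omega) (hx.ch n) trivial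
      · rw [hc n h2, phiII, if_neg (hhi n hn'), hanc n hn', if_neg (hexe n), if_neg, if_neg]
        · exact (fmove_spec hFn (hnU n hn') (by rw [(hx n).1]; exact h2)).2
        · exact fun h => (hstayS n h).1 hFn
        · exact fun h => h.2.1 hFn
    have hQ : QS T (S0 s q) q := by
      refine ⟨hS0 _ le_rfl, fun v hv hb => ?_, fun v hv hb w hw hF => ?_⟩
      · by_contra hcon
        push Not at hcon
        refine hv (F_theirs (by omega) fun w hw _ => ?_)
        by_contra hF
        exact hcon w hw hF
      · exact hv (F_mine hb hw trivial hF)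
    have hone : legal T K TA q (.one (S0 s q)) := ⟨(hx _).1, hQ⟩
    have htg : tg s q (.one (S0 s q)) = .stay (S0 s q) := by
      refine (tg_K1 hone).resolve_right ?_
      rintro ⟨u, hu⟩
      exact (hUleg _ _ hone hu).1 (F_base ⟨_, hone, hu⟩)
    have hmv : mv s q (.one (S0 s q)) = x (K+2) := by
      rw [hc (K+1) (by omega), ← hqd, phiII, if_neg (hhi _ le_rfl), anc_of_lvl (hx _).1,
        if_neg (hexe _), if_pos hone]
    have hstep : ∀ m, K + 2 ≤ m → m % 2 = 1 → legal T K TA (x m) (.stay (S0 s q)) →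
        mv s (x m) (.stay (S0 s q)) = x (m+1) := by
      intro m hm h2 hl
      rw [hc m h2, phiII, if_neg (hhi m (by omega)), hanc m (by omega), if_neg (hexe m), if_neg,
        if_pos hl]
      intro h
      have h3 := h.1
      rw [(hx m).1] at h3
      omega
    have hL : ∀ m, K + 2 ≤ m → legal T K TA (x m) (.stay (S0 s q)) := by
      intro m hm
      induction m, hm using Nat.le_induction with
      | base =>
        have := mv_legal (s := s) hone
        rwa [htg, hmv] at this
      | succ m hm ih =>
        rcases Nat.mod_two_eq_zero_or_one m with h2 | h2
        · refine stay_child ih (hx.ch m) (hS0 _ (by omega)) fun hF => (hstayS m ih).2 ?_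
          exact F_mine (by rw [(hx m).1]; exact h2) (hx.ch m) (hS0 _ (by omega)) hF
        · have h3 := mv_legal (s := s) ih
          rwa [tg_high ih ih.1, hstep m hm h2 ih] at h3
    exact build hx (t := .stay (S0 s q)) rfl hQ hL (fun m hm => hlow m hm.le)
      (fun h => by omega) (fun _ => ⟨hmv, htg⟩) fun m hm h2 => hstep m hm h2 (hL m hm)

variable (T K TA hK)

noncomputable def UC : Cov K (UT T K TA hK) T where
  π p := p.1.1
  lvl_π _ := rfl
  par_π _ := rfl
  inj v w h e := by
    have h1 : T.lvl v.1.1 ≤ K := h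
    refine Subtype.ext (Prod.ext e ?_)
    rw [legal_none_iff v.2 h1, legal_none_iff w.2 (by rw [← e]; exact h1)]
  surj v h := ⟨⟨(v, .none), h⟩, rfl⟩
  φ b s := if b = 0 then ⟨phiI s, phiI_ch s⟩ else ⟨phiII s, phiII_ch s⟩
  φ_loc b s s' n h v hv := by
    split_ifs
    · exact phiI_loc h hv
    · exact phiII_loc h hv
  φ_id b s v h := by
    have h1 : T.lvl v.1.1 < K := h
    have e := legal_none_iff v.2 h1.le
    have e2 : mv s v.1.1 .none = (s.1 v).1.1 := by
      rw [← e]; unfold mv; rw [dif_pos v.2]; rfl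
    split_ifs
    · change phiI s v.1.1 = _
      rw [phiI, if_pos h1.le, e2]
    · change phiII s v.1.1 = _
      rw [phiII, if_pos h1.le, e2]
  lift b s x hb hx hc := by
    by_cases h0 : b = 0
    · subst h0
      exact liftI s hx fun n hn => hc n hn
    · obtain rfl : b = 1 := by omega
      exact liftII s hx fun n hn => hc n hn

lemma UC_clo (A : Set (ℕ → T.V)) (hA : T.Op Aᶜ) (hTA : TA = fun v => ∃ y, T.IsRun y ∧ y ∈ A ∧
    y (T.lvl v) = v) : (UT T K TA hK).Clo ((UC T K TA hK).toTMap.pre A) := by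
  have tag : ∀ x, (UT T K TA hK).IsRun x → ∀ m, K + 2 ≤ m → (x m).1.2 = (x (K+2)).1.2 := by
    intro x hx m hm
    induction m, hm using Nat.le_induction with
    | base => rfl
    | succ m hm ih =>
      have h1 := (UT_ch (hx.ch m)).2
      have h2 : T.lvl (x m).1.1 = m := (hx m).1
      rw [h2] at h1
      unfold trunc at h1
      rw [if_neg (by omega), if_neg (by omega)] at h1
      rw [h1, ih]
  have hr : ∀ x, (UT T K TA hK).IsRun x → T.IsRun fun n => (x n).1.1 :=
    fun x hx => (UC T K TA hK).toTMap.run hx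
  have exit : ∀ x, (UT T K TA hK).IsRun x → ∀ S u, (x (K+2)).1.2 = .exit S u →
      x ∉ (UC T K TA hK).toTMap.pre A := by
    intro x hx S u h hxA
    have hl := (x (T.lvl u + K + 2)).2
    rw [tag x hx _ (by omega), h] at hl
    have h2 := hl.2.2.2.2.2.2
    have h3 : T.lvl (x (T.lvl u + K + 2)).1.1 = T.lvl u + K + 2 := (hx _).1
    have h4 := h2 (by omega)
    rw [(hr x hx).anc (m := T.lvl u + K + 2) (by omega)] at h4
    have h5 := hl.2.2.2.1
    exact h5 ((congrFun hTA _).mpr ⟨_, hr x hx, hxA, h4⟩)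
  have stay : ∀ x, (UT T K TA hK).IsRun x → ∀ S, (x (K+2)).1.2 = .stay S →
      x ∈ (UC T K TA hK).toTMap.pre A := by
    intro x hx S h
    by_contra hxA
    obtain ⟨n, hn⟩ := hA _ (hr x hx) hxA
    have hl := (x (n + K + 2)).2
    rw [tag x hx _ (by omega), h] at hl
    have h3 : T.lvl (x (n + K + 2)).1.1 = n + K + 2 := (hx _).1
    have h4 := (hl.2.2 (n + K + 2) (by omega) (by omega)).2
    rw [anc_of_lvl h3] at h4
    refine h4 (F_base fun hTAx => ?_)
    obtain ⟨y, hy, hyA, e⟩ := (congrFun hTA _).mp hTAx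
    rw [h3] at e
    refine hn y hy (hy.eq_of_le (hr x hx) (m := n + K + 2) (by omega) e) hyA
  have cases : ∀ x, (UT T K TA hK).IsRun x → (∃ S, (x (K+2)).1.2 = .stay S) ∨
      ∃ S u, (x (K+2)).1.2 = .exit S u := by
    intro x hx
    have h3 : T.lvl (x (K+2)).1.1 = K + 2 := (hx _).1
    rcases (legal_ge (x (K+2)).2 (by omega)).1 with h | ⟨u, h⟩
    · exact Or.inl ⟨_, h⟩
    · exact Or.inr ⟨_, _, h⟩
  constructor
  · intro x hx hxA
    refine ⟨K+2, fun y hy e => ?_⟩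
    rcases cases x hx with ⟨S, h⟩ | ⟨S, u, h⟩
    · exact stay y hy S (by rw [e, h])
    · exact absurd hxA (exit x hx S u h)
  · intro x hx hxA
    refine ⟨K+2, fun y hy e => ?_⟩
    rcases cases x hx with ⟨S, h⟩ | ⟨S, u, h⟩
    · exact absurd (stay x hx S h) hxA
    · exact exit y hy S u (by rw [e, h])

end unravel2

/-- every closed set is unravelled by some `k`-covering -/
theorem unravel_closed (T : Tr) (k : ℕ) (A : Set (ℕ → T.V)) (hA : T.Op Aᶜ) :
    ∃ (T' : Tr) (c : Cov k T' T), T'.Clo (c.toTMap.pre A) :=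
  ⟨_, (UC T (2 * k) (fun v => ∃ y, T.IsRun y ∧ y ∈ A ∧ y (T.lvl v) = v) (by omega)).mono (by omega),
    UC_clo T (2 * k) _ (by omega) A hA rfl⟩

end BD

open scoped ENNReal NNReal Classical

namespace BD
open Tr

lemma Tr.Clo.compl {T : Tr} {A : Set (ℕ → T.V)} (h : T.Clo A) : T.Clo Aᶜ :=
  ⟨h.2, by rw [compl_compl]; exact h.1⟩

/-- hereditarily unravelable sets -/
def Unr (T : Tr) (A : Set (ℕ → T.V)) : Prop :=
  ∀ (T' : Tr) (f : TMap T' T) (k : ℕ), ∃ (T'' : Tr) (c : Cov k T'' T'),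
    T''.Clo ((c.toTMap.comp f).pre A)

lemma Unr.of_level {T : Tr} {A : Set (ℕ → T.V)} (m : ℕ)
    (h : ∀ x y, T.IsRun x → T.IsRun y → x m = y m → x ∈ A → y ∈ A) : Unr T A := by
  intro T' f k
  refine ⟨T', Cov.id k T', ?_⟩
  apply TMap.pre_clo
  refine ⟨fun x hx hxA => ⟨m, fun y hy e => h x y hx hy e.symm hxA⟩,
    fun x hx hxA => ⟨m, fun y hy e hyA => hxA (h y x hy hx e hyA)⟩⟩

lemma Unr.compl {T : Tr} {A : Set (ℕ → T.V)} (h : Unr T A) : Unr T Aᶜ := by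
  intro T' f k
  obtain ⟨T'', c, hc⟩ := h T' f k
  exact ⟨T'', c, hc.compl⟩

lemma Unr.iUnion {T : Tr} {A : ℕ → Set (ℕ → T.V)} (h : ∀ n, Unr T (A n)) :
    Unr T (⋃ n, A n) := by
  intro T' f k
  choose T2 c2 hclo using h
  let seq : ℕ → Σ T' : Tr, TMap T' T := fun n => Nat.rec ⟨T', f⟩
    (fun n p => ⟨T2 n p.1 p.2 (k+n), (c2 n p.1 p.2 (k+n)).toTMap.comp p.2⟩) n
  let TT : ℕ → Tr := fun n => (seq n).1
  let c : ∀ n, Cov (k+n) (TT (n+1)) (TT n) := fun n => c2 n (seq n).1 (seq n).2 (k+n)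
  have hc : ∀ n, (seq (n+1)).1.Clo ((seq (n+1)).2.pre (A n)) := fun n =>
    hclo n (seq n).1 (seq n).2 (k+n)
  have hv : ∀ (n : ℕ) (v : LV c), (seq n).2.π (v.1 n) = f.π (v.1 0) := by
    intro n v
    induction n with
    | zero => rfl
    | succ n ih =>
      rw [← ih, ← v.2 n]; rfl
  set B := ((limCov c).toTMap.comp f).pre (⋃ n, A n) with hB
  have hBo : (LT c).Op B := by
    intro x hx hxB
    obtain ⟨n, hn⟩ := Set.mem_iUnion.1 (show (fun m => f.π ((x m).1 0)) ∈ ⋃ n, A n from hxB)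
    have h1 := ((limProj c (n+1)).pre_clo (hc n)).1 x hx (by
      have e : (fun m => (seq (n+1)).2.π ((x m).1 (n+1))) = fun m => f.π ((x m).1 0) :=
        funext fun m => hv (n+1) (x m)
      have h0 : (fun m => (seq (n+1)).2.π ((x m).1 (n+1))) ∈ A n := by rw [e]; exact hn
      exact h0)
    obtain ⟨m, hm⟩ := h1
    refine ⟨m, fun y hy e => ?_⟩
    have h2 := hm y hy e
    have e : (fun m => (seq (n+1)).2.π ((y m).1 (n+1))) = fun m => f.π ((y m).1 0) :=
      funext fun m => hv (n+1) (y m)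
    have h3 : (fun m => f.π ((y m).1 0)) ∈ A n := e ▸ h2
    exact Set.mem_iUnion.2 ⟨n, h3⟩
  obtain ⟨T'', c', hc'⟩ := unravel_closed (LT c) k Bᶜ (by rwa [compl_compl])
  refine ⟨T'', c'.comp (limCov c), ?_⟩
  have := hc'.compl
  have e : (c'.toTMap.pre Bᶜ)ᶜ = c'.toTMap.pre B := compl_compl _
  rw [e] at this
  exact this

theorem determinacy {T : Tr} {A : Set (ℕ → T.V)} (h : Unr T A) (v0 : T.V) (hv0 : T.lvl v0 = 0) :
    (∃ s : T.Strat, ∀ x, T.IsRun x → x 0 = v0 → T.Conform 0 s x → x ∈ A) ∨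
    (∃ s : T.Strat, ∀ x, T.IsRun x → x 0 = v0 → T.Conform 1 s x → x ∉ A) := by
  obtain ⟨T', c, hc⟩ := h T (TMap.id T) 0
  obtain ⟨v0', hv0'⟩ := c.surj v0 (by omega)
  have key : ∀ (x : ℕ → T.V) (x' : ℕ → T'.V), x 0 = v0 → T'.IsRun x' → (∀ n, c.π (x' n) = x n) →
      x' 0 = v0' ∧ ((x' ∈ (c.toTMap.comp (TMap.id T)).pre A) ↔ x ∈ A) := by
    intro x x' h0 hx' e
    refine ⟨c.inj _ _ (by rw [(hx' 0).1]) (by rw [e, h0, hv0']), ?_⟩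
    have : (fun n => c.π (x' n)) = x := funext e
    change (fun n => c.π (x' n)) ∈ A ↔ _
    rw [this]
  rcases open_det v0' _ hc.1 with ⟨s, hs⟩ | ⟨s, hs⟩
  · refine Or.inl ⟨c.φ 0 s, fun x hx h0 hcf => ?_⟩
    obtain ⟨x', h1, h2, h3⟩ := c.lift 0 s x (by omega) hx hcf
    obtain ⟨h4, h5⟩ := key x x' h0 h1 h3
    exact h5.1 (hs x' h1 h4 h2)
  · refine Or.inr ⟨c.φ 1 s, fun x hx h0 hcf hxA => ?_⟩
    obtain ⟨x', h1, h2, h3⟩ := c.lift 1 s x (by omega) hx hcf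
    obtain ⟨h4, h5⟩ := key x x' h0 h1 h3
    exact hs x' h1 h4 h2 (h5.2 hxA)

/-! ### Gale-Stewart games with alternating moves from `X` and `Y` -/

section GS
variable (X Y : Type) [Nonempty X] [Nonempty Y]

/-- initial segment of a sequence -/
def pre {Z : Type} (z : ℕ → Z) (n : ℕ) : List Z := (List.range n).map z

lemma pre_succ {Z : Type} (z : ℕ → Z) (n : ℕ) : pre z (n+1) = pre z n ++ [z n] := by
  simp [pre, List.range_succ]

lemma pre_length {Z : Type} (z : ℕ → Z) (n : ℕ) : (pre z n).length = n := by simp [pre]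

/-- all sequences -/
noncomputable def FT : Tr where
  V := List (X × Y)
  lvl l := l.length
  par l := l.dropLast
  lvl_par l := List.length_dropLast
  ex_child l := ⟨l ++ [Classical.arbitrary _], by simp, by simp⟩

variable {X Y}

noncomputable def lastD (l : List (X × Y)) : X × Y := l.getLastD (Classical.arbitrary _)

lemma lastD_append (l : List (X × Y)) (z : X × Y) : lastD (l ++ [z]) = z := by
  simp [lastD]

lemma FT_ch {l l' : List (X × Y)} (h : (FT X Y).Ch l l') : l' = l ++ [lastD l'] := by
  obtain ⟨h1, h2⟩ := h
  change l'.length = l.length + 1 at h1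
  change l'.dropLast = l at h2
  have hne : l' ≠ [] := by intro h; simp [h] at h1
  obtain ⟨a, z, rfl⟩ : ∃ a z, l' = a ++ [z] := ⟨_, _, (List.dropLast_append_getLast hne).symm⟩
  simp at h2
  rw [lastD_append, h2]

/-- the plays of a run -/
noncomputable def plays (x : ℕ → List (X × Y)) : (ℕ → X) × (ℕ → Y) :=
  (fun n => (lastD (x (2*n+1))).1, fun n => (lastD (x (2*n+2))).2)

variable (X Y) in
/-- Borel sets -/
@[reducible] def borelXY : MeasurableSpace ((ℕ → X) × (ℕ → Y)) :=
  MeasurableSpace.generateFrom {W | ∃ n, ∀ p q : (ℕ → X) × (ℕ → Y),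
    (∀ k < n, p.1 k = q.1 k ∧ p.2 k = q.2 k) → p ∈ W → q ∈ W}

lemma unr_of_measurable {W : Set ((ℕ → X) × (ℕ → Y))} (hW : @MeasurableSet _ (borelXY X Y) W) :
    Unr (FT X Y) (plays ⁻¹' W) := by
  refine MeasurableSpace.generateFrom_induction _
    (fun W _ => Unr (FT X Y) (plays ⁻¹' W)) ?_ ?_ ?_ ?_ W hW
  · rintro W ⟨n, hn⟩ -
    refine Unr.of_level (2 * n) fun x y hx hy e h => hn _ _ (fun k hk => ?_) h
    have h1 := hx.eq_of_le hy (n := 2 * k + 1) (by omega) e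
    have h2 := hx.eq_of_le hy (n := 2 * k + 2) (by omega) e
    simp only [plays]
    exact ⟨congrArg (fun l => (lastD l).1) h1, congrArg (fun l => (lastD l).2) h2⟩
  · exact Unr.of_level 0 fun _ _ _ _ _ h => h
  · intro W _ h; exact h.compl
  · intro W _ h
    have := Unr.iUnion h
    have e : (⋃ n, plays ⁻¹' W n) = plays ⁻¹' (⋃ n, W n) := Set.preimage_iUnion.symm
    exact e ▸ this

theorem gs_det {W : Set ((ℕ → X) × (ℕ → Y))} (hW : @MeasurableSet _ (borelXY X Y) W) :
    (∃ sI : List Y → X, ∀ y : ℕ → Y, (fun n => sI (pre y n), y) ∈ W) ∨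
    (∃ sII : List X → Y, ∀ x : ℕ → X, (x, fun n => sII (pre x (n+1))) ∉ W) := by
  obtain ⟨x0⟩ := ‹Nonempty X›
  obtain ⟨y0⟩ := ‹Nonempty Y›
  have h2n : ∀ n, 2 * n / 2 = n := fun n => by omega
  have h2n1 : ∀ n, (2 * n + 1) / 2 = n := fun n => by omega
  have hrun : ∀ x : ℕ → List (X × Y), x 0 = [] → (∀ n, ∃ z, x (n+1) = x n ++ [z]) →
      (FT X Y).IsRun x := by
    intro x h0 h
    have hl : ∀ n, (x n).length = n := by
      intro n
      induction n with
      | zero => simp [h0]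
      | succ n ih => obtain ⟨z, hz⟩ := h n; simp [hz, ih]
    intro n
    refine ⟨hl n, ?_⟩
    obtain ⟨z, hz⟩ := h n
    change (x (n+1)).dropLast = x n
    simp [hz]
  rcases determinacy (unr_of_measurable hW) ([] : List (X × Y)) rfl with ⟨s, hs⟩ | ⟨s, hs⟩
  · left
    let g : List (X × Y) → List (X × Y) := s.1
    have hg : ∀ l, ∃ z, g l = l ++ [z] := fun l => ⟨_, FT_ch (s.2 l)⟩
    have hs' : ∀ x : ℕ → List (X × Y), x 0 = [] → (∀ n, ∃ z, x (n+1) = x n ++ [z]) →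
        (∀ n, n % 2 = 0 → x (n+1) = g (x n)) → plays x ∈ W :=
      fun x h0 h1 h2 => hs x (hrun x h0 h1) h0 h2
    clear_value g
    let st : List (X × Y) → Y → List (X × Y) := fun p y => g p ++ [(x0, y)]
    let pos : List Y → List (X × Y) := fun l => l.foldl st []
    refine ⟨fun l => (lastD (g (pos l))).1, fun y => ?_⟩
    let x : ℕ → List (X × Y) := fun m =>
      if m % 2 = 0 then pos (pre y (m/2)) else g (pos (pre y (m/2)))
    have he : ∀ n, x (2*n) = pos (pre y n) := fun n => by simp [x]
    have ho : ∀ n, x (2*n+1) = g (x (2*n)) := fun n => by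
      rw [he]; simp only [x]; rw [if_neg (by omega), h2n1]
    have hp : ∀ n, x (2*n+2) = x (2*n+1) ++ [(x0, y n)] := fun n => by
      rw [show 2*n+2 = 2*(n+1) by ring, he, ho, he, pre_succ]
      simp [pos, st]
    have := hs' x (by simp [x, pos, pre]) (fun n => by
      rcases Nat.even_or_odd' n with ⟨m, rfl | rfl⟩
      · rw [ho]; exact hg _
      · exact ⟨_, hp m⟩) (fun n hn => by
      obtain ⟨m, rfl⟩ : ∃ m, n = 2 * m := ⟨n/2, by omega⟩
      exact ho m)
    have e : plays x = (fun n => (lastD (g (pos (pre y n)))).1, y) := by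
      refine Prod.ext (funext fun n => ?_) (funext fun n => ?_)
      · simp only [plays]; rw [ho, he]
      · simp only [plays]; rw [hp, lastD_append]
    rw [← e]; exact this
  · right
    let g : List (X × Y) → List (X × Y) := s.1
    have hg : ∀ l, ∃ z, g l = l ++ [z] := fun l => ⟨_, FT_ch (s.2 l)⟩
    have hs' : ∀ x : ℕ → List (X × Y), x 0 = [] → (∀ n, ∃ z, x (n+1) = x n ++ [z]) →
        (∀ n, n % 2 = 1 → x (n+1) = g (x n)) → plays x ∉ W :=
      fun x h0 h1 h2 => hs x (hrun x h0 h1) h0 h2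
    clear_value g
    let st : List (X × Y) → X → List (X × Y) := fun p x => g (p ++ [(x, y0)])
    let pos : List X → List (X × Y) := fun l => l.foldl st []
    refine ⟨fun l => (lastD (pos l)).2, fun y => ?_⟩
    let x : ℕ → List (X × Y) := fun m =>
      if m % 2 = 0 then pos (pre y (m/2)) else pos (pre y (m/2)) ++ [(y (m/2), y0)]
    have he : ∀ n, x (2*n) = pos (pre y n) := fun n => by simp [x]
    have ho : ∀ n, x (2*n+1) = x (2*n) ++ [(y n, y0)] := fun n => by
      rw [he]; simp only [x]; rw [if_neg (by omega), h2n1]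
    have hp : ∀ n, x (2*n+2) = g (x (2*n+1)) := fun n => by
      rw [show 2*n+2 = 2*(n+1) by ring, he, ho, he, pre_succ]
      simp [pos, st]
    have := hs' x (by simp [x, pos, pre]) (fun n => by
      rcases Nat.even_or_odd' n with ⟨m, rfl | rfl⟩
      · exact ⟨_, ho m⟩
      · have := hp m
        rw [show 2*m+1+1 = 2*m+2 by ring, this]; exact hg _) (fun n hn => by
      obtain ⟨m, rfl⟩ : ∃ m, n = 2 * m + 1 := ⟨n/2, by omega⟩
      exact hp m)
    have e : plays x = (y, fun n => (lastD (pos (pre y (n+1)))).2) := by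
      refine Prod.ext (funext fun n => ?_) (funext fun n => ?_)
      · simp only [plays]; rw [ho, lastD_append]
      · simp only [plays]; rw [show 2*n+2 = 2*(n+1) by ring, he]
    rw [← e]; exact this

end GS
end BD

open scoped ENNReal NNReal Classical
open MeasureTheory

namespace StochGame
variable {G : StochGame}

abbrev Yt (G : StochGame) := G.ActionProfile × G.S

/-- the one-step law -/
noncomputable def wt (t : G.S) (x : ∀ i, PMF (G.A i)) (z : Yt G) : ℝ≥0∞ :=
  (∏ i, x i (z.1 i)) * G.trans t z.1 z.2

lemma wt_sum (t : G.S) (x : ∀ i, PMF (G.A i)) : ∑' z, wt t x z = 1 := by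
  rw [ENNReal.tsum_prod']
  simp only [wt]
  simp only [ENNReal.tsum_mul_left, PMF.tsum_coe, mul_one]
  rw [tsum_fintype]
  have := Finset.prod_univ_sum (fun i : G.I => (Finset.univ : Finset (G.A i)))
    (fun i a => x i a)
  rw [Fintype.piFinset_univ] at this
  rw [← this]
  refine Finset.prod_eq_one fun i _ => ?_
  rw [← tsum_fintype (L := SummationFilter.unconditional _)]
  exact (x i).tsum_coe

noncomputable def wtP (t : G.S) (x : ∀ i, PMF (G.A i)) : PMF (Yt G) :=
  ⟨wt t x, wt_sum t x ▸ ENNReal.summable.hasSum⟩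

/-- the one-step law as a measure -/
noncomputable def mu (t : G.S) (x : ∀ i, PMF (G.A i)) : Measure (Yt G) := (wtP t x).toMeasure

instance (t : G.S) (x : ∀ i, PMF (G.A i)) : IsProbabilityMeasure (mu t x) := by
  unfold mu; infer_instance

lemma mu_singleton (t : G.S) (x : ∀ i, PMF (G.A i)) (z : Yt G) : mu t x {z} = wt t x z := by
  unfold mu
  rw [PMF.toMeasure_apply_singleton _ _ (measurableSet_singleton z)]
  rfl

lemma integrable_bdd {Ω : Type*} [MeasurableSpace Ω] {μ : Measure Ω} [IsFiniteMeasure μ]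
    {f : Ω → ℝ} (hf : Measurable f) {C : ℝ} (h : ∀ z, |f z| ≤ C) : Integrable f μ :=
  Integrable.of_bound hf.aestronglyMeasurable C (Filter.Eventually.of_forall h)

lemma integrable_mu {t : G.S} {x : ∀ i, PMF (G.A i)} {ψ : Yt G → ℝ} {C : ℝ} (h : ∀ z, |ψ z| ≤ C) :
    Integrable ψ (mu t x) :=
  integrable_bdd (Measurable.of_discrete) h

/-- one-step minmax operator -/
noncomputable def V1 (i : G.I) (t : G.S) (ψ : Yt G → ℝ) : ℝ :=
  ⨅ x : ∀ j, PMF (G.A j), ⨆ y : PMF (G.A i), ∫ z, ψ z ∂(mu t (Function.update x i y))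

lemma oneShotExp_eq {D : G.History → ℝ} {C : ℝ} (hD : ∀ h, |D h| ≤ C) (h : G.History)
    (x : ∀ i, PMF (G.A i)) :
    oneShotExp D h x = ∫ z, D (snocH h z.1 z.2) ∂(mu (lastState h) x) := by
  have hi : Integrable (fun z : Yt G => D (snocH h z.1 z.2)) (mu (lastState h) x) :=
    integrable_mu fun z => hD _
  have h1 := PMF.integral_eq_tsum (wtP (lastState h) x) _ hi
  unfold mu
  rw [h1]
  have hs : Summable fun z : Yt G => (wt (lastState h) x z).toReal * D (snocH h z.1 z.2) := by
    have h0 : Summable fun z : Yt G => (wt (lastState h) x z).toReal :=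
      ENNReal.summable_toReal (by rw [wt_sum]; simp)
    refine Summable.of_norm_bounded (h0.mul_right C) fun z => ?_
    rw [norm_mul, Real.norm_of_nonneg ENNReal.toReal_nonneg]
    exact mul_le_mul_of_nonneg_left (hD _) ENNReal.toReal_nonneg
  have e : (fun z : Yt G => ((wtP (lastState h) x) z).toReal • D (snocH h z.1 z.2)) =
    fun z : Yt G => (wt (lastState h) x z).toReal * D (snocH h z.1 z.2) := rfl
  rw [e, Summable.tsum_prod hs, tsum_fintype]
  unfold oneShotExp
  refine Finset.sum_congr rfl fun a _ => ?_
  simp only [wt, ENNReal.toReal_mul, ENNReal.toReal_prod]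
  simp only [mul_assoc, tsum_mul_left]

lemma oneShotMinmax_eq {D : G.History → ℝ} {C : ℝ} (hD : ∀ h, |D h| ≤ C) (i : G.I)
    (h : G.History) :
    oneShotMinmax D i h = V1 i (lastState h) (fun z => D (snocH h z.1 z.2)) := by
  unfold oneShotMinmax V1
  simp only [oneShotExp_eq hD]

section V1
variable {i : G.I} {t : G.S} {ψ φ : Yt G → ℝ} {C C' : ℝ}

lemma abs_int_le (h : ∀ z, |ψ z| ≤ C) (x : ∀ i, PMF (G.A i)) : |∫ z, ψ z ∂(mu t x)| ≤ C := by
  have := norm_integral_le_of_norm_le_const (μ := mu t x) (f := ψ) (C := C)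
    (Filter.Eventually.of_forall h)
  simpa using this

lemma bddA (h : ∀ z, |ψ z| ≤ C) (x : ∀ i, PMF (G.A i)) :
    BddAbove (Set.range fun y : PMF (G.A i) => ∫ z, ψ z ∂(mu t (Function.update x i y))) :=
  ⟨C, by rintro _ ⟨y, rfl⟩; exact (abs_le.1 (abs_int_le h _)).2⟩

instance (i : G.I) : Nonempty (PMF (G.A i)) := ⟨PMF.pure (Classical.arbitrary _)⟩

lemma bddB (h : ∀ z, |ψ z| ≤ C) :
    BddBelow (Set.range fun x : ∀ j, PMF (G.A j) =>
      ⨆ y : PMF (G.A i), ∫ z, ψ z ∂(mu t (Function.update x i y))) :=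
  ⟨-C, by
    rintro _ ⟨x, rfl⟩
    exact le_ciSup_of_le (bddA h x) (Classical.arbitrary _) (abs_le.1 (abs_int_le h _)).1⟩

lemma V1_exists_x (h : ∀ z, |ψ z| ≤ C) {δ : ℝ} (hδ : 0 < δ) : ∃ x : ∀ j, PMF (G.A j),
    ∀ y : PMF (G.A i), ∫ z, ψ z ∂(mu t (Function.update x i y)) ≤ V1 i t ψ + δ := by
  obtain ⟨x, hx⟩ := exists_lt_of_ciInf_lt (show V1 i t ψ < V1 i t ψ + δ by linarith)
  exact ⟨x, fun y => (le_ciSup (bddA h x) y).trans hx.le⟩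

lemma V1_exists_y (h : ∀ z, |ψ z| ≤ C) {δ : ℝ} (hδ : 0 < δ) (x : ∀ j, PMF (G.A j)) :
    ∃ y : PMF (G.A i), V1 i t ψ - δ ≤ ∫ z, ψ z ∂(mu t (Function.update x i y)) := by
  have h1 : V1 i t ψ ≤ ⨆ y : PMF (G.A i), ∫ z, ψ z ∂(mu t (Function.update x i y)) :=
    ciInf_le (bddB h) x
  obtain ⟨y, hy⟩ := exists_lt_of_lt_ciSup (lt_of_lt_of_le (show V1 i t ψ - δ < _ by linarith) h1)
  exact ⟨y, hy.le⟩

lemma V1_mono (h : ∀ z, |ψ z| ≤ C) (h' : ∀ z, |φ z| ≤ C') (hle : ∀ z, ψ z ≤ φ z) :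
    V1 i t ψ ≤ V1 i t φ :=
  ciInf_mono (bddB h) fun x => ciSup_mono (bddA h' x) fun y =>
    integral_mono (integrable_mu h) (integrable_mu h') hle

lemma V1_sub_const (h : ∀ z, |ψ z| ≤ C) (c : ℝ) :
    V1 i t (fun z => ψ z - c) = V1 i t ψ - c := by
  unfold V1
  have : ∀ x : ∀ j, PMF (G.A j), ∫ z, (ψ z - c) ∂(mu t x) = ∫ z, ψ z ∂(mu t x) - c := by
    intro x
    rw [integral_sub (integrable_mu h) (integrable_const c)]; simp
  simp only [this]
  rw [show (⨅ x : ∀ j, PMF (G.A j), ⨆ y : PMF (G.A i),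
    ∫ z, ψ z ∂(mu t (Function.update x i y))) - c = _ from ciInf_sub (bddB h) c]
  congr 1; funext x
  rw [ciSup_sub (bddA h x) c]

lemma V1_const (c : ℝ) : V1 i t (fun _ => c) = c := by
  simp [V1]

lemma V1_le (h : ∀ z, |ψ z| ≤ C) {c : ℝ} (hc : ∀ z, ψ z ≤ c) : V1 i t ψ ≤ c := by
  have := V1_mono (i := i) (t := t) h (φ := fun _ => c) (C' := |c|) (fun _ => le_rfl) hc
  rwa [V1_const] at this

lemma le_V1 (h : ∀ z, |ψ z| ≤ C) {c : ℝ} (hc : ∀ z, c ≤ ψ z) : c ≤ V1 i t ψ := by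
  have := V1_mono (i := i) (t := t) (ψ := fun _ => c) (C := |c|) (fun _ => le_rfl) h hc
  rwa [V1_const] at this

end V1

/-! ### Histories, cylinders and laws -/

lemma catH_nil (h : G.History) : catH h [] = h := by simp [catH]

lemma catH_catH (h : G.History) (l l' : List (Yt G)) : catH (catH h l) l' = catH h (l ++ l') := by
  simp [catH]

lemma snocH_catH (h : G.History) (l : List (Yt G)) (z : Yt G) :
    snocH (catH h l) z.1 z.2 = catH h (l ++ [z]) := by
  simp [snocH, catH]

lemma snocH_eq (h : G.History) (z : Yt G) : snocH h z.1 z.2 = catH h [z] := rfl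

lemma contProb_append (σ : G.Profile) (h : G.History) (l l' : List (Yt G)) :
    contProb σ h (l ++ l') = contProb σ h l * contProb σ (catH h l) l' := by
  induction l generalizing h with
  | nil => simp [contProb, catH_nil]
  | cons z l ih =>
    obtain ⟨a, s⟩ := z
    simp only [List.cons_append, contProb, ih]
    have e : catH (snocH h a s) l = catH h ((a, s) :: l) := by simp [catH, snocH]
    rw [e, mul_assoc]
    simp only [mul_assoc]

lemma contProb_single (σ : G.Profile) (h : G.History) (z : Yt G) :
    contProb σ h [z] = wt (lastState h) (fun j => σ j h) z := by
  obtain ⟨a, s⟩ := z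
  simp [contProb, wt]

lemma contProb_snoc (σ : G.Profile) (h : G.History) (l : List (Yt G)) (z : Yt G) :
    contProb σ h (l ++ [z]) = contProb σ h l *
      wt (lastState (catH h l)) (fun j => σ j (catH h l)) z := by
  rw [contProb_append, contProb_single]

lemma validFrom_snoc (s : G.S) (l : List (Yt G)) (z : Yt G) :
    ValidFrom G s (l ++ [z]) ↔ ValidFrom G s l ∧ G.trans (lastState (s, l)) z.1 z.2 ≠ 0 := by
  induction l generalizing s with
  | nil => simp [ValidFrom, lastState]
  | cons y l ih =>
    obtain ⟨a, t⟩ := y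
    simp only [List.cons_append, ValidFrom, ih, and_assoc]
    have : lastState ((s, (a, t) :: l) : G.History) = lastState ((t, l) : G.History) := by
      unfold lastState
      cases l using List.reverseRecOn with
      | nil => simp
      | append_singleton l y => rw [← List.cons_append, List.getLast?_concat, List.getLast?_concat]; rfl
    rw [this]

lemma valid_of_contProb (σ : G.Profile) (h : G.History) (hv : Valid h) (l : List (Yt G))
    (hl : contProb σ h l ≠ 0) : Valid (catH h l) := by
  induction l using List.reverseRecOn with
  | nil => rwa [catH_nil]
  | append_singleton l z ih =>
    rw [contProb_snoc] at hl
    have h1 := ih (left_ne_zero_of_mul hl)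
    have h2 := right_ne_zero_of_mul (right_ne_zero_of_mul hl)
    rw [← snocH_catH]
    exact (validFrom_snoc _ _ _).2 ⟨h1, h2⟩

lemma ext_catH (h : G.History) (l : List (Yt G)) : Ext h (catH h l) := ⟨rfl, by simp [catH]⟩

instance instMSList : MeasurableSpace (List (Yt G)) := ⊤

/-- the first `n` steps after the history `h` -/
def ln (h : G.History) (n : ℕ) (r : G.Run) : List (Yt G) :=
  BD.pre (fun k => r.2 (h.2.length + k)) n

lemma ln_succ (h : G.History) (n : ℕ) (r : G.Run) :
    ln h (n+1) r = ln h n r ++ [r.2 (h.2.length + n)] := BD.pre_succ _ _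

lemma ln_length (h : G.History) (n : ℕ) (r : G.Run) : (ln h n r).length = n := BD.pre_length _ _

lemma measurable_coord (k : ℕ) : Measurable fun r : G.Run => r.2 k :=
  (measurable_pi_apply k).comp measurable_snd

lemma measurable_ln (h : G.History) (n : ℕ) : Measurable (ln h n) := by
  induction n with
  | zero => exact measurable_const
  | succ n ih =>
    have h1 : Measurable fun r : G.Run => (ln h n r, r.2 (h.2.length + n)) :=
      ih.prodMk (measurable_coord _)
    have h2 : Measurable fun p : List (Yt G) × Yt G => p.1 ++ [p.2] := Measurable.of_discrete
    have h3 := h2.comp h1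
    have e : ln h (n+1) = (fun p : List (Yt G) × Yt G => p.1 ++ [p.2]) ∘
        fun r : G.Run => (ln h n r, r.2 (h.2.length + n)) := funext fun r => ln_succ h n r
    rw [e]; exact h3

lemma pre_eq_iff {Z : Type} (z : ℕ → Z) (l : List Z) :
    BD.pre z l.length = l ↔ ∀ k, (hk : k < l.length) → z k = l.get ⟨k, hk⟩ := by
  constructor
  · intro h k hk
    have : l[k]? = some (z k) := by
      conv_lhs => rw [← h]
      simp [BD.pre, hk]
    rw [List.getElem?_eq_getElem hk] at this
    simpa using this.symm
  · intro h
    apply List.ext_getElem (BD.pre_length _ _)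
    intro k h1 h2
    simp [BD.pre, h k h2]

lemma cyl_catH (h : G.History) (l : List (Yt G)) :
    cyl (catH h l) = cyl h ∩ {r | ln h l.length r = l} := by
  ext r
  simp only [cyl, catH, Set.mem_ofPred_eq, Set.mem_inter_iff, ln, pre_eq_iff, and_assoc]
  refine and_congr_right fun _ => ⟨fun H => ⟨fun k hk => ?_, fun k hk => ?_⟩, fun H k hk => ?_⟩
  · rw [H k (by simp; omega)]; simp [hk]
  · rw [H (h.2.length + k) (by simp; omega)]; simp
  · rcases Nat.lt_or_ge k h.2.length with h1 | h1
    · rw [H.1 k h1]; simp [h1]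
    · simp at hk
      have := H.2 (k - h.2.length) (by omega)
      rw [Nat.add_sub_cancel' h1] at this
      rw [this]; simp [List.getElem_append_right h1]

section law
variable {P : G.History → G.Profile → Measure G.Run} (hP : IsInducedFamily G P)
  (h : G.History) (σ : G.Profile)

lemma measurableSet_cyl (h : G.History) : MeasurableSet (cyl h) := by
  have : cyl h = {r | r.1 = h.1} ∩ {r | ln (h.1, []) h.2.length r = h.2} := by
    ext r
    simp only [cyl, Set.mem_ofPred_eq, Set.mem_inter_iff, ln, pre_eq_iff, List.length_nil, zero_add]
  rw [this]
  exact (measurable_fst (measurableSet_singleton h.1)).inter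
    (measurable_ln _ _ (measurableSet_singleton h.2))

lemma ae_cyl (hP : IsInducedFamily G P) : ∀ᵐ r ∂(P h σ), r ∈ cyl h := by
  haveI := hP.1 h σ
  have := hP.2 h σ []
  rw [catH_nil, contProb] at this
  exact (prob_compl_eq_zero_iff (measurableSet_cyl h)).2 this

lemma law_ln (hP : IsInducedFamily G P) (l : List (Yt G)) :
    P h σ {r | ln h l.length r = l} = contProb σ h l := by
  rw [← hP.2 h σ l, cyl_catH]
  apply measure_congr
  filter_upwards [ae_cyl h σ hP] with r hr
  exact propext ⟨fun h => ⟨hr, h⟩, fun h => h.2⟩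

lemma law_zero (hP : IsInducedFamily G P) {n : ℕ} {l : List (Yt G)} (hl : l.length ≠ n) :
    {r : G.Run | ln h n r = l} = ∅ := by
  ext r
  simp only [Set.mem_ofPred_eq, Set.mem_empty_iff_false, iff_false]
  rintro rfl
  exact hl (ln_length _ _ _)

lemma step_map (hP : IsInducedFamily G P) (l : List (Yt G)) :
    ((P h σ).restrict {r | ln h l.length r = l}).map (fun r => r.2 (h.2.length + l.length)) =
      contProb σ h l • mu (lastState (catH h l)) (fun j => σ j (catH h l)) := by
  apply Measure.ext_of_singleton
  intro z
  rw [Measure.map_apply (measurable_coord _) (measurableSet_singleton z),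
    Measure.restrict_apply (measurable_coord _ (measurableSet_singleton z)), Measure.smul_apply,
    mu_singleton, smul_eq_mul, ← contProb_snoc, ← law_ln h σ hP]
  congr 1
  ext r
  simp only [List.length_append, List.length_singleton, ln_succ, Set.mem_inter_iff,
    Set.mem_preimage, Set.mem_singleton_iff, Set.mem_ofPred_eq]
  constructor
  · rintro ⟨h1, h2⟩; rw [h1, h2]
  · intro h1
    have := List.append_inj h1 (ln_length _ _ _)
    exact ⟨by simpa using this.2, this.1⟩

lemma step_fiber (hP : IsInducedFamily G P) (l : List (Yt G)) (b : List (Yt G) → ℝ) :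
    ∫ r in {r | ln h l.length r = l}, b (ln h (l.length+1) r) ∂(P h σ) =
      (contProb σ h l).toReal *
        ∫ z, b (l ++ [z]) ∂(mu (lastState (catH h l)) (fun j => σ j (catH h l))) := by
  have h1 : ∫ r in {r | ln h l.length r = l}, b (ln h (l.length+1) r) ∂(P h σ) =
      ∫ r in {r | ln h l.length r = l}, b (l ++ [r.2 (h.2.length + l.length)]) ∂(P h σ) := by
    refine setIntegral_congr_fun (measurable_ln _ _ (measurableSet_singleton l)) fun r hr => ?_
    have hr' : ln h l.length r = l := hr
    simp only [ln_succ, hr']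
  rw [h1, ← smul_eq_mul, ← integral_smul_measure, ← step_map h σ hP, integral_map]
  · exact (measurable_coord _).aemeasurable
  · exact Measurable.aestronglyMeasurable Measurable.of_discrete

/-- one-step inequality on sets of the filtration -/
lemma step_le (hP : IsInducedFamily G P) (n : ℕ) {a b : List (Yt G) → ℝ} {C : ℝ}
    (ha : ∀ l, |a l| ≤ C) (hb : ∀ l, |b l| ≤ C)
    (hab : ∀ l, l.length = n → contProb σ h l ≠ 0 →
      a l ≤ ∫ z, b (l ++ [z]) ∂(mu (lastState (catH h l)) (fun j => σ j (catH h l))))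
    (B : Set (List (Yt G))) :
    ∫ r in ln h n ⁻¹' B, a (ln h n r) ∂(P h σ) ≤
      ∫ r in ln h n ⁻¹' B, b (ln h (n+1) r) ∂(P h σ) := by
  haveI := hP.1 h σ
  have hU : ln h n ⁻¹' B = ⋃ l : B, {r | ln h n r = l} := by
    ext r; simp
  have hm : ∀ l : B, MeasurableSet {r | ln h n r = l} := fun l =>
    measurable_ln _ _ (measurableSet_singleton l.1)
  have hd : Pairwise (Function.onFun Disjoint fun l : B => {r | ln h n r = l}) := by
    intro l l' hne
    refine Set.disjoint_left.2 fun r h1 h2 => hne (Subtype.ext ?_)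
    exact (show ln h n r = l from h1).symm.trans h2
  have ia : Integrable (fun r => a (ln h n r)) (P h σ) :=
    integrable_bdd ((Measurable.of_discrete (f := a)).comp (measurable_ln h n)) fun r => ha _
  have ib : Integrable (fun r => b (ln h (n+1) r)) (P h σ) :=
    integrable_bdd ((Measurable.of_discrete (f := b)).comp (measurable_ln h (n+1))) fun r => hb _
  rw [hU]
  refine hasSum_le (fun l => ?_) (hasSum_integral_iUnion hm hd ia.integrableOn)
    (hasSum_integral_iUnion hm hd ib.integrableOn)
  obtain ⟨l, hlB⟩ := l
  by_cases hl : l.length = n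
  · subst hl
    have e : ∫ r in {r | ln h l.length r = l}, a (ln h l.length r) ∂(P h σ) =
        (contProb σ h l).toReal * a l := by
      have e0 : ∫ r in {r | ln h l.length r = l}, a (ln h l.length r) ∂(P h σ) =
          ∫ r in {r | ln h l.length r = l}, a l ∂(P h σ) :=
        setIntegral_congr_fun (measurable_ln _ _ (measurableSet_singleton l))
          (fun r hr => congrArg a hr)
      rw [e0, setIntegral_const, smul_eq_mul, Measure.real, law_ln h σ hP]
    change ∫ r in {r | ln h l.length r = l}, a (ln h l.length r) ∂(P h σ) ≤ _
    rw [e, step_fiber h σ hP]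
    by_cases h0 : contProb σ h l = 0
    · simp [h0]
    · exact mul_le_mul_of_nonneg_left (hab l rfl h0) ENNReal.toReal_nonneg
  · simp [law_zero h hP hl]

end law
end StochGame

open scoped ENNReal NNReal Classical
open MeasureTheory

namespace StochGame
variable {G : StochGame}

lemma ln_take (h : G.History) {m n : ℕ} (hmn : m ≤ n) (r : G.Run) :
    (ln h n r).take m = ln h m r := by
  simp [ln, BD.pre, ← List.map_take, List.take_range, hmn]

/-- the filtration generated by the first steps after `h` -/
def filt (h : G.History) : Filtration ℕ (inferInstance : MeasurableSpace G.Run) where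
  seq n := MeasurableSpace.comap (ln h n) ⊤
  mono' := by
    intro m n hmn
    rintro _ ⟨B, -, rfl⟩
    refine ⟨{l | l.take m ∈ B}, trivial, ?_⟩
    ext r
    simp only [Set.mem_preimage, Set.mem_ofPred_eq, ln_take h hmn r]
  le' n := by
    rintro _ ⟨B, hB, rfl⟩
    exact measurable_ln h n hB

section law
variable {P : G.History → G.Profile → Measure G.Run}
  (h : G.History) (σ : G.Profile)

lemma meas_u (u : List (Yt G) → ℝ) (n : ℕ) : Measurable fun r => u (ln h n r) :=
  (Measurable.of_discrete (f := u)).comp (measurable_ln h n)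

lemma sub_conv (hP : IsInducedFamily G P) {u : List (Yt G) → ℝ} {C : ℝ}
    (hu : ∀ l, |u l| ≤ C)
    (hs : ∀ l, contProb σ h l ≠ 0 →
      u l ≤ ∫ z, u (l ++ [z]) ∂(mu (lastState (catH h l)) (fun j => σ j (catH h l)))) :
    ∃ g : G.Run → ℝ, (∀ᵐ r ∂(P h σ), Filter.Tendsto (fun n => u (ln h n r)) Filter.atTop
      (nhds (g r))) ∧ u [] ≤ ∫ r, g r ∂(P h σ) ∧ Integrable g (P h σ) := by
  have := hP.1 h σ
  have hi : ∀ n, Integrable (fun r => u (ln h n r)) (P h σ) := fun n =>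
    integrable_bdd (meas_u h u n) fun r => hu _
  have hsub : Submartingale (fun n r => u (ln h n r)) (filt h) (P h σ) := by
    refine submartingale_of_setIntegral_le_succ (fun n => ?_) hi ?_
    · apply Measurable.stronglyMeasurable
      exact (Measurable.of_discrete (f := u)).comp (comap_measurable (ln h n))
    · rintro n s ⟨B, -, rfl⟩
      exact step_le h σ hP n hu hu (fun l _ hl => hs l hl) B
  have hC : 0 ≤ C := (abs_nonneg _).trans (hu [])
  have hb : ∀ n, eLpNorm (fun r => u (ln h n r)) 1 (P h σ) ≤ (C.toNNReal : ℝ≥0∞) := by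
    intro n
    have hae : ∀ᵐ r ∂(P h σ), ‖u (ln h n r)‖ ≤ C := Filter.Eventually.of_forall fun r => hu _
    refine (eLpNorm_le_of_ae_bound hae).trans ?_
    simp [ENNReal.ofReal]
  have ht := hsub.ae_tendsto_limitProcess hb
  refine ⟨_, ht, ?_, ?_⟩
  · have h1 := tendsto_integral_of_dominated_convergence (fun _ => C)
      (fun n => (hi n).aestronglyMeasurable) (integrable_const C)
      (fun n => Filter.Eventually.of_forall fun r => hu _) ht
    have hmono : ∀ n, u [] ≤ ∫ r, u (ln h n r) ∂(P h σ) := by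
      intro n
      have := hsub.setIntegral_le (Nat.zero_le n) (MeasurableSet.univ)
      simpa [ln, BD.pre] using this
    exact ge_of_tendsto' h1 hmono
  · refine Integrable.of_bound (MeasureTheory.Filtration.stronglyMeasurable_limit_process'.aestronglyMeasurable) C ?_
    filter_upwards [ht] with r hr
    exact le_of_tendsto' hr.norm fun n => hu _

/-- The basic comparison lemma: a bounded almost-submartingale whose limits are dominated by `f`. -/
lemma core_le (hP : IsInducedFamily G P) {u : List (Yt G) → ℝ} {C : ℝ}
    (hu : ∀ l, |u l| ≤ C) {δ : ℕ → ℝ} (hδ : ∀ n, 0 ≤ δ n) {S : ℝ}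
    (hS : ∀ n, ∑ k ∈ Finset.range n, δ k ≤ S)
    (hs : ∀ l, contProb σ h l ≠ 0 →
      u l - δ l.length ≤
        ∫ z, u (l ++ [z]) ∂(mu (lastState (catH h l)) (fun j => σ j (catH h l))))
    {f : G.Run → ℝ} (hf : Integrable f (P h σ))
    (hlim : ∀ᵐ r ∂(P h σ), ∀ c, Filter.Tendsto (fun n => u (ln h n r)) Filter.atTop (nhds c) →
      c ≤ f r) :
    u [] - S ≤ ∫ r, f r ∂(P h σ) := by
  have := hP.1 h σ
  have hS0 : 0 ≤ S := by simpa using hS 0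
  set u' : List (Yt G) → ℝ := fun l => u l + ∑ k ∈ Finset.range l.length, δ k with hu'
  have hb : ∀ l, |u' l| ≤ C + S := fun l => by
    refine (abs_add_le _ _).trans (add_le_add (hu l) ?_)
    rw [abs_of_nonneg (Finset.sum_nonneg fun k _ => hδ k)]
    exact hS _
  obtain ⟨g, hg, hg1, hgi⟩ := sub_conv h σ hP hb (by
    intro l hl
    have h1 := hs l hl
    simp only [hu', List.length_append, List.length_singleton]
    rw [integral_add (integrable_mu fun z => hu _) (integrable_const _)]
    simp only [integral_const, probReal_univ, smul_eq_mul, one_mul, Finset.sum_range_succ]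
    linarith)
  have hT : Filter.Tendsto (fun n => ∑ k ∈ Finset.range n, δ k) Filter.atTop
      (nhds (∑' k, δ k)) := (summable_of_sum_range_le hδ hS).hasSum.tendsto_sum_nat
  have hTS : ∑' k, δ k ≤ S := le_of_tendsto' hT hS
  have h2 : ∫ r, (g r - S) ∂(P h σ) ≤ ∫ r, f r ∂(P h σ) := by
    refine integral_mono_ae (hgi.sub (integrable_const S)) hf ?_
    filter_upwards [hg, hlim] with r h1 h2
    have h3 := h2 (g r - ∑' k, δ k) (by
      have := h1.sub hT
      simp only [hu', ln_length, add_sub_cancel_right] at this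
      exact this)
    change g r - S ≤ f r
    linarith
  rw [integral_sub hgi (integrable_const S)] at h2
  simp only [integral_const, probReal_univ, smul_eq_mul, one_mul] at h2
  have h4 : u' [] = u [] := by simp [hu']
  linarith

/-- Borel–Cantelli for gaining events. -/
lemma core_restart (hP : IsInducedFamily G P) {u : List (Yt G) → ℝ} {C : ℝ}
    (hu : ∀ l, |u l| ≤ C) {δ : ℕ → ℝ} (hδ : ∀ n, 0 ≤ δ n) {S : ℝ}
    (hS : ∀ n, ∑ k ∈ Finset.range n, δ k ≤ S) (R : Set (List (Yt G))) {e : ℝ} (he : 0 < e)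
    (hs : ∀ l, contProb σ h l ≠ 0 →
      u l + R.indicator (fun _ => e) l - δ l.length ≤
        ∫ z, u (l ++ [z]) ∂(mu (lastState (catH h l)) (fun j => σ j (catH h l)))) :
    ∀ᵐ r ∂(P h σ), ∀ᶠ n in Filter.atTop, ln h n r ∉ R := by
  have := hP.1 h σ
  have hi : ∀ n, Integrable (fun r => u (ln h n r)) (P h σ) := fun n =>
    integrable_bdd (meas_u h u n) fun r => hu _
  have hm : ∀ n, MeasurableSet {r | ln h n r ∈ R} := fun n =>
    measurable_ln h n (MeasurableSpace.measurableSet_top (s := R))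
  have step : ∀ n, ∫ r, u (ln h n r) ∂(P h σ) + e * (P h σ).real {r | ln h n r ∈ R} - δ n ≤
      ∫ r, u (ln h (n+1) r) ∂(P h σ) := by
    intro n
    have hB : ∀ l, |u l + R.indicator (fun _ => e) l - δ n| ≤ C + e + δ n := by
      intro l
      have h1 : |R.indicator (fun _ => e) l| ≤ e := by
        by_cases hl : l ∈ R
        · simp [hl, abs_of_pos he]
        · simp [hl, he.le]
      have h2 := abs_le.1 h1
      have h3 := abs_le.1 (hu l)
      have h4 := hδ n
      rw [abs_le]; constructor <;> linarith
    have := step_le h σ hP n (a := fun l => u l + R.indicator (fun _ => e) l - δ n) (b := u)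
      hB (fun l => (hu l).trans (by have := hδ n; linarith))
      (fun l hl h0 => by have := hs l h0; rw [hl] at this; exact this) Set.univ
    simp only [Set.preimage_univ, setIntegral_univ] at this
    refine le_trans (le_of_eq ?_) this
    have hind : Integrable (fun r => R.indicator (fun _ => e) (ln h n r)) (P h σ) :=
      integrable_bdd (C := e) (meas_u h _ n) fun r => by
        by_cases hl : ln h n r ∈ R
        · simp [hl, abs_of_pos he]
        · simp [hl, he.le]
    have hadd : Integrable (fun r => u (ln h n r) + R.indicator (fun _ => e) (ln h n r)) (P h σ) :=
      (hi n).add hind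
    rw [integral_sub hadd (integrable_const _), integral_add (hi n) hind]
    have e1 : (fun r => R.indicator (fun _ => e) (ln h n r)) =
        {r | ln h n r ∈ R}.indicator (fun _ => e) := by
      funext r
      by_cases hl : ln h n r ∈ R
      · simp [Set.indicator, hl]
      · simp [Set.indicator, hl]
    rw [e1, integral_indicator (hm n), setIntegral_const]
    simp only [integral_const, probReal_univ, smul_eq_mul, one_mul]
    ring
  have hbd : ∀ n, |∫ r, u (ln h n r) ∂(P h σ)| ≤ C := fun n => by
    have := norm_integral_le_of_norm_le_const (μ := P h σ) (f := fun r => u (ln h n r)) (C := C)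
      (Filter.Eventually.of_forall fun r => hu _)
    simpa using this
  have hsum : ∀ n, e * ∑ k ∈ Finset.range n, (P h σ).real {r | ln h k r ∈ R} ≤
      ∫ r, u (ln h n r) ∂(P h σ) + C + ∑ k ∈ Finset.range n, δ k := by
    intro n
    induction n with
    | zero => simp only [Finset.range_zero, Finset.sum_empty, mul_zero, add_zero]
              have := (abs_le.1 (hbd 0)).1
              linarith
    | succ n ih =>
      rw [Finset.sum_range_succ, Finset.sum_range_succ, mul_add]
      have := step n
      linarith
  have hsm : Summable fun k => (P h σ).real {r | ln h k r ∈ R} := by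
    refine summable_of_sum_range_le (c := (2*C+S)/e) (fun _ => measureReal_nonneg) fun n => ?_
    rw [le_div_iff₀ he, mul_comm]
    have h1 := hsum n
    have h2 := (abs_le.1 (hbd n)).2
    have h3 := hS n
    linarith
  refine ae_eventually_notMem (s := fun n => {r | ln h n r ∈ R}) ?_
  have h5 : ∀ k, P h σ {r | ln h k r ∈ R} =
      ENNReal.ofReal ((P h σ).real {r | ln h k r ∈ R}) := fun k => by simp
  simp_rw [h5]
  exact hsm.tsum_ofReal_ne_top

end law
end StochGame

open scoped ENNReal NNReal Classical
open MeasureTheory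

namespace BD

lemma fin_dep_meas {X Y : Type} {W : Set ((ℕ → X) × (ℕ → Y))} (n : ℕ)
    (h : ∀ p q, (∀ k < n, p.1 k = q.1 k ∧ p.2 k = q.2 k) → p ∈ W → q ∈ W) :
    @MeasurableSet _ (borelXY X Y) W :=
  MeasurableSpace.measurableSet_generateFrom ⟨n, h⟩

lemma fin_dep_fun {X Y Z : Type} [MeasurableSpace Z] {g : (ℕ → X) × (ℕ → Y) → Z} (n : ℕ)
    (h : ∀ p q : (ℕ → X) × (ℕ → Y), (∀ k < n, p.1 k = q.1 k ∧ p.2 k = q.2 k) → g p = g q) :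
    @Measurable _ _ (borelXY X Y) _ g := fun s _ =>
  fin_dep_meas n fun p q hpq hp => by
    have : g p ∈ s := hp
    rw [h p q hpq] at this
    exact this

lemma meas_win {X Y : Type} {L : ℕ → Set ((ℕ → X) × (ℕ → Y))}
    (hL : ∀ n, ∀ p q, (∀ k < n+1, p.1 k = q.1 k ∧ p.2 k = q.2 k) → p ∈ L n → q ∈ L n)
    {g : ℕ → (ℕ → X) × (ℕ → Y) → ℝ}
    (hg : ∀ n, ∀ p q : (ℕ → X) × (ℕ → Y),
      (∀ k < n+1, p.1 k = q.1 k ∧ p.2 k = q.2 k) → g n p = g n q)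
    {F : (ℕ → X) × (ℕ → Y) → ℝ} (hF : @Measurable _ _ (borelXY X Y) _ F) :
    @MeasurableSet _ (borelXY X Y)
      {p | (∀ n, p ∈ L n) ∧ ∀ k : ℕ, ∃ N, ∀ n ≥ N, g n p ≤ F p + 1/((k:ℝ)+1)} := by
  letI := borelXY X Y
  have hg' : ∀ n, Measurable (g n) := fun n => fin_dep_fun (n+1) (hg n)
  have hL' : ∀ n, MeasurableSet (L n) := fun n => fin_dep_meas (n+1) (hL n)
  have e : {p | (∀ n, p ∈ L n) ∧ ∀ k : ℕ, ∃ N, ∀ n ≥ N, g n p ≤ F p + 1/((k:ℝ)+1)} =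
      (⋂ n, L n) ∩ ⋂ k : ℕ, ⋃ N : ℕ, ⋂ n : ℕ, ⋂ _ : n ≥ N, {p | g n p ≤ F p + 1/((k:ℝ)+1)} := by
    ext p; simp
  rw [e]
  refine (MeasurableSet.iInter hL').inter (MeasurableSet.iInter fun k => MeasurableSet.iUnion
    fun N => MeasurableSet.iInter fun n => MeasurableSet.iInter fun _ => ?_)
  exact measurableSet_le (hg' n) (hF.add_const _)

lemma pre_getD {Z : Type} (l : List Z) (c : Z) : pre (fun k => l[k]?.getD c) l.length = l := by
  apply List.ext_getElem (pre_length _ _)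
  intro k h1 h2
  simp [pre, h2]

lemma pre_congr {Z : Type} {z z' : ℕ → Z} {n : ℕ} (h : ∀ k < n, z k = z' k) :
    pre z n = pre z' n := by
  simp only [pre]
  exact List.map_congr_left fun k hk => h k (List.mem_range.1 hk)

end BD

namespace StochGame
variable {G : StochGame}
open BD

/-- the run that follows `h0` and then `y` -/
noncomputable def runOf (h0 : G.History) (y : ℕ → Yt G) : G.Run :=
  (h0.1, fun k => if hk : k < h0.2.length then h0.2.get ⟨k, hk⟩ else y (k - h0.2.length))

lemma runOf_of_cyl (h0 : G.History) {r : G.Run} (hr : r ∈ cyl h0) :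
    runOf h0 (fun k => r.2 (h0.2.length + k)) = r := by
  refine Prod.ext hr.1.symm (funext fun k => ?_)
  simp only [runOf]
  split_ifs with hk
  · exact (hr.2 k hk).symm
  · rw [Nat.add_sub_cancel' (not_lt.1 hk)]

lemma measurable_runOf (h0 : G.History) {X : Type} :
    @Measurable _ _ (borelXY X (Yt G)) _ (fun p : (ℕ → X) × (ℕ → Yt G) => runOf h0 p.2) := by
  letI := borelXY X (Yt G)
  refine Measurable.prodMk measurable_const (measurable_pi_lambda _ fun k => ?_)
  refine fin_dep_fun (k+1) fun p q hpq => ?_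
  split_ifs with hk
  · rfl
  · exact (hpq _ (by omega)).2

def tgt (w0 : ℝ) (x : ℕ → Yt G → ℝ) (y : ℕ → Yt G) : ℕ → ℝ
  | 0 => w0
  | n+1 => x n (y n)

def Leg (i : G.I) (h0 : G.History) (M : ℝ) (l : List (Yt G)) (w : ℝ) (d : Yt G → ℝ) : Prop :=
  (∀ z, |d z| ≤ M) ∧ w ≤ V1 i (lastState (catH h0 l)) d

lemma tgt_congr {w0 : ℝ} {x x' : ℕ → Yt G → ℝ} {y y' : ℕ → Yt G} {n : ℕ}
    (h : ∀ k < n, x k = x' k ∧ y k = y' k) : tgt w0 x y n = tgt w0 x' y' n := by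
  cases n with
  | zero => rfl
  | succ n => simp only [tgt]; rw [(h n (by omega)).1, (h n (by omega)).2]

/-- player I wins the auxiliary game -/
def auxW (i : G.I) (h0 : G.History) (M w0 : ℝ) : Set ((ℕ → Yt G → ℝ) × (ℕ → Yt G)) :=
  {p | (∀ n, p ∈ {p : (ℕ → Yt G → ℝ) × (ℕ → Yt G) |
      Leg i h0 M (pre p.2 n) (tgt w0 p.1 p.2 n) (p.1 n)}) ∧
    ∀ k : ℕ, ∃ N, ∀ n ≥ N, p.1 n (p.2 n) ≤ G.payoff i (runOf h0 p.2) + 1/((k:ℝ)+1)}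

lemma auxW_meas (i : G.I) (hfm : Measurable (G.payoff i)) (h0 : G.History) (M w0 : ℝ) :
    @MeasurableSet _ (borelXY (Yt G → ℝ) (Yt G)) (auxW i h0 M w0) := by
  refine meas_win (L := fun n => {p : (ℕ → Yt G → ℝ) × (ℕ → Yt G) |
      Leg i h0 M (pre p.2 n) (tgt w0 p.1 p.2 n) (p.1 n)}) (g := fun n p => p.1 n (p.2 n))
    (F := fun p => G.payoff i (runOf h0 p.2)) ?_ ?_ ?_
  · intro n p q hpq hp
    have h1 : pre p.2 n = pre q.2 n := pre_congr fun k hk => (hpq k (by omega)).2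
    have h2 : tgt w0 p.1 p.2 n = tgt w0 q.1 q.2 n := tgt_congr fun k hk => hpq k (by omega)
    have hp' : Leg i h0 M (pre p.2 n) (tgt w0 p.1 p.2 n) (p.1 n) := hp
    rw [h1, h2, (hpq n (by omega)).1] at hp'
    exact hp'
  · intro n p q hpq
    change p.1 n (p.2 n) = q.1 n (q.2 n)
    rw [(hpq n (by omega)).1, (hpq n (by omega)).2]
  · letI := borelXY (Yt G → ℝ) (Yt G)
    exact hfm.comp (measurable_runOf h0)

instance : Nonempty (Yt G) := ⟨(fun _ => Classical.arbitrary _, Classical.arbitrary _)⟩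

/-- what the Key Lemma asserts -/
def KeyD (i : G.I) (h0 : G.History) (M w0 : ℝ) (d : List (Yt G) → ℝ) : Prop :=
  d [] = w0 ∧ (∀ l, |d l| ≤ M) ∧
  (∀ l, d l ≤ V1 i (lastState (catH h0 l)) (fun z => d (l ++ [z]))) ∧
  ∀ y : ℕ → Yt G, ∀ k : ℕ, ∃ N, ∀ n ≥ N,
    d (pre y n) ≤ G.payoff i (runOf h0 y) + 1/((k:ℝ)+1)

lemma key_of_I {i : G.I} {h0 : G.History} {M w0 : ℝ} (hw0 : |w0| ≤ M)
    {sI : List (Yt G) → (Yt G → ℝ)}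
    (hs : ∀ y : ℕ → Yt G, (fun n => sI (pre y n), y) ∈ auxW i h0 M w0) :
    ∃ d, KeyD i h0 M w0 d := by
  set d : List (Yt G) → ℝ := fun l => l.getLast?.elim w0 (fun z => sI l.dropLast z) with hd
  have d0 : d [] = w0 := by simp [hd]
  have d1 : ∀ l z, d (l ++ [z]) = sI l z := fun l z => by simp [hd]
  have ht : ∀ (y : ℕ → Yt G) n, tgt w0 (fun n => sI (pre y n)) y n = d (pre y n) := by
    intro y n
    cases n with
    | zero => simp [tgt, pre, d0]
    | succ n => rw [pre_succ, d1]; rfl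
  have hl : ∀ l, Leg i h0 M l (d l) (sI l) := by
    intro l
    have h1 := (hs (fun k => l[k]?.getD (Classical.arbitrary _))).1 l.length
    change Leg i h0 M (pre _ l.length) (tgt w0 _ _ l.length) (sI (pre _ l.length)) at h1
    rw [ht, pre_getD] at h1
    exact h1
  refine ⟨d, d0, fun l => ?_, fun l => ?_, fun y k => ?_⟩
  · rcases List.eq_nil_or_concat l with rfl | ⟨l, z, rfl⟩
    · rwa [d0]
    · rw [List.concat_eq_append, d1]; exact (hl l).1 z
  · simp only [d1]; exact (hl l).2
  · obtain ⟨N, hN⟩ := (hs y).2 k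
    refine ⟨N+1, fun n hn => ?_⟩
    obtain ⟨m, rfl⟩ : ∃ m, n = m+1 := ⟨n-1, by omega⟩
    rw [pre_succ, d1]
    exact hN m (by omega)

section II
variable (i : G.I) (h0 : G.History) (M w0 : ℝ) (sII : List (Yt G → ℝ) → Yt G) (δ : ℕ → ℝ)

/-- responses -/
def resp (x : ℕ → Yt G → ℝ) (n : ℕ) : Yt G := sII (pre x (n+1))

def InvT (l : List (Yt G)) (xs : List (Yt G → ℝ)) (w : ℝ) : Prop :=
  xs.length = l.length ∧ ∀ x : ℕ → Yt G → ℝ, pre x l.length = xs →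
    pre (resp sII x) l.length = l ∧
    (∀ k < l.length, Leg i h0 M (pre (resp sII x) k) (tgt w0 x (resp sII x) k) (x k)) ∧
    tgt w0 x (resp sII x) l.length = w

/-- set of legal moves answered by `z` -/
def Mv (l : List (Yt G)) (s : List (Yt G → ℝ) × ℝ) (z : Yt G) : Set (Yt G → ℝ) :=
  {d | Leg i h0 M l s.2 d ∧ sII (s.1 ++ [d]) = z}

noncomputable def psi (l : List (Yt G)) (s : List (Yt G → ℝ) × ℝ) (z : Yt G) : ℝ :=
  if (Mv i h0 M sII l s z).Nonempty then sInf ((fun d => d z) '' Mv i h0 M sII l s z) else M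

lemma exists_pick (l : List (Yt G)) (s : List (Yt G → ℝ) × ℝ) (z : Yt G)
    (hne : (Mv i h0 M sII l s z).Nonempty) {e : ℝ} (he : 0 < e) :
    ∃ d ∈ Mv i h0 M sII l s z, d z ≤ psi i h0 M sII l s z + e := by
  rw [psi, if_pos hne]
  obtain ⟨_, ⟨d, hd, rfl⟩, h⟩ := Real.lt_sInf_add_pos (hne.image (fun d => d z)) he
  exact ⟨d, hd, h.le⟩

noncomputable def stp (l : List (Yt G)) (z : Yt G) (s : List (Yt G → ℝ) × ℝ) :
    Option (List (Yt G → ℝ) × ℝ) :=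
  if hh : ∃ d ∈ Mv i h0 M sII l s z, d z ≤ psi i h0 M sII l s z + δ l.length then
    some (s.1 ++ [hh.choose], hh.choose z) else none

/-- tracked auxiliary position, on reversed lists -/
noncomputable def trk' : List (Yt G) → Option (List (Yt G → ℝ) × ℝ)
  | [] => some ([], w0)
  | z :: m => (trk' m).bind (stp i h0 M sII δ m.reverse z)

noncomputable def trk (l : List (Yt G)) : Option (List (Yt G → ℝ) × ℝ) :=
  trk' i h0 M w0 sII δ l.reverse

lemma trk_nil : trk i h0 M w0 sII δ [] = some ([], w0) := rfl

lemma trk_snoc (l : List (Yt G)) (z : Yt G) : trk i h0 M w0 sII δ (l ++ [z]) =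
    (trk i h0 M w0 sII δ l).bind (stp i h0 M sII δ l z) := by
  simp [trk, trk']

noncomputable def wv (l : List (Yt G)) : ℝ := (trk i h0 M w0 sII δ l).elim M Prod.snd

variable {i h0 M w0 sII δ}

lemma inv_step {l : List (Yt G)} {xs : List (Yt G → ℝ)} {w : ℝ} (hI : InvT i h0 M w0 sII l xs w)
    {d : Yt G → ℝ} {z : Yt G} (hL : Leg i h0 M l w d) (hz : sII (xs ++ [d]) = z) :
    InvT i h0 M w0 sII (l ++ [z]) (xs ++ [d]) (d z) := by
  refine ⟨by simp [hI.1], fun x hx => ?_⟩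
  simp only [List.length_append, List.length_singleton] at hx ⊢
  have hx' := hx
  rw [pre_succ] at hx
  obtain ⟨h1, h2⟩ := List.append_inj hx (by rw [pre_length, hI.1])
  have h3 : x l.length = d := by simpa using h2
  obtain ⟨g1, g2, g3⟩ := hI.2 x h1
  have g4 : resp sII x l.length = z := by rw [resp, hx', hz]
  refine ⟨by rw [pre_succ, g1, g4], fun k hk => ?_, by rw [tgt, h3, g4]⟩
  rcases Nat.lt_succ_iff_lt_or_eq.1 hk with hk | rfl
  · exact g2 k hk
  · rw [g1, g3, h3]; exact hL

lemma trk_inv (l : List (Yt G)) : ∀ s, trk i h0 M w0 sII δ l = some s →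
    InvT i h0 M w0 sII l s.1 s.2 := by
  induction l using List.reverseRecOn with
  | nil =>
    rintro s hs
    rw [trk_nil] at hs
    obtain rfl := Option.some.inj hs
    refine ⟨rfl, fun x _ => ⟨rfl, fun k hk => by simp at hk, rfl⟩⟩
  | append_singleton l z ih =>
    intro s hs
    rw [trk_snoc, Option.bind_eq_some_iff] at hs
    obtain ⟨s', hs', hs⟩ := hs
    rw [stp] at hs
    split_ifs at hs with hh
    obtain rfl := Option.some.inj hs
    have := hh.choose_spec
    exact inv_step (ih s' hs') this.1.1 this.1.2

variable {C : ℝ} (hC : ∀ r, |G.payoff i r| ≤ C) (hCM : C < M) (hw0 : |w0| ≤ M)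
  (hII : ∀ x : ℕ → Yt G → ℝ, (x, fun n => sII (pre x (n+1))) ∉ auxW i h0 M w0)

lemma inv_abs {l : List (Yt G)} {xs : List (Yt G → ℝ)} {w : ℝ} (hw0 : |w0| ≤ M)
    (hI : InvT i h0 M w0 sII l xs w) : |w| ≤ M := by
  have h1 := hI.2 (fun k => xs[k]?.getD (fun _ => 0)) (by rw [← hI.1, pre_getD])
  obtain ⟨-, h2, h3⟩ := h1
  rw [← h3]
  cases hn : l.length with
  | zero => exact hw0
  | succ n => exact (h2 n (by omega)).1 _

lemma inv_ge (hC : ∀ r, |G.payoff i r| ≤ C) (hw0 : |w0| ≤ M)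
    (hII : ∀ x : ℕ → Yt G → ℝ, (x, fun n => sII (pre x (n+1))) ∉ auxW i h0 M w0)
    {l : List (Yt G)} {xs : List (Yt G → ℝ)} {w : ℝ}
    (hI : InvT i h0 M w0 sII l xs w) : -C ≤ w := by
  by_contra hlt
  push Not at hlt
  set x : ℕ → Yt G → ℝ := fun k => xs[k]?.getD (fun _ => w) with hx
  have hx1 : pre x l.length = xs := by rw [← hI.1, hx, pre_getD]
  have hx2 : ∀ k, l.length ≤ k → x k = fun _ => w := fun k hk => by
    simp [hx, List.getElem?_eq_none (show xs.length ≤ k by rw [hI.1]; exact hk)]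
  obtain ⟨g1, g2, g3⟩ := hI.2 x hx1
  have ht : ∀ k, l.length ≤ k → tgt w0 x (resp sII x) k = w := by
    intro k hk
    rcases hk.eq_or_lt with rfl | hk
    · exact g3
    · obtain ⟨m, rfl⟩ : ∃ m, k = m+1 := ⟨k-1, by omega⟩
      rw [tgt, hx2 m (by omega)]
  refine hII x ⟨fun n => ?_, fun k => ⟨l.length, fun n hn => ?_⟩⟩
  · change Leg i h0 M (pre (resp sII x) n) (tgt w0 x (resp sII x) n) (x n)
    rcases Nat.lt_or_ge n l.length with hn | hn
    · exact g2 n hn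
    · rw [ht n hn, hx2 n hn]
      exact ⟨fun _ => inv_abs hw0 hI, by rw [V1_const]⟩
  · change x n _ ≤ _
    rw [hx2 n hn]
    have := (abs_le.1 (hC (runOf h0 fun n => sII (pre x (n+1))))).1
    have h1 : (0:ℝ) ≤ 1/((k:ℝ)+1) := by positivity
    change w ≤ G.payoff i (runOf h0 fun n => sII (pre x (n+1))) + _
    linarith

lemma psi_bounds (hC : ∀ r, |G.payoff i r| ≤ C) (hCM : C < M) (hw0 : |w0| ≤ M)
    (hII : ∀ x : ℕ → Yt G → ℝ, (x, fun n => sII (pre x (n+1))) ∉ auxW i h0 M w0)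
    {l : List (Yt G)} {s : List (Yt G → ℝ) × ℝ}
    (hI : InvT i h0 M w0 sII l s.1 s.2) (z : Yt G) :
    -C ≤ psi i h0 M sII l s z ∧ psi i h0 M sII l s z ≤ M ∧
      ∀ d ∈ Mv i h0 M sII l s z, psi i h0 M sII l s z ≤ d z := by
  have hC0 : 0 ≤ C := (abs_nonneg _).trans (hC (runOf h0 fun _ => z))
  have hlow : ∀ d ∈ Mv i h0 M sII l s z, -C ≤ d z := fun d hd =>
    inv_ge hC hw0 hII (inv_step hI hd.1 hd.2)
  have hB : BddBelow ((fun d : Yt G → ℝ => d z) '' Mv i h0 M sII l s z) :=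
    ⟨-C, by rintro _ ⟨d, hd, rfl⟩; exact hlow d hd⟩
  by_cases hne : (Mv i h0 M sII l s z).Nonempty
  · rw [psi, if_pos hne]
    have h3 : ∀ d ∈ Mv i h0 M sII l s z,
        sInf ((fun d : Yt G → ℝ => d z) '' Mv i h0 M sII l s z) ≤ d z :=
      fun d hd => csInf_le hB ⟨d, hd, rfl⟩
    refine ⟨le_csInf (hne.image _) ?_, ?_, h3⟩
    · rintro _ ⟨d, hd, rfl⟩; exact hlow d hd
    · obtain ⟨d, hd⟩ := hne
      exact (h3 d hd).trans (abs_le.1 (hd.1.1 z)).2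
  · rw [psi, if_neg hne]
    exact ⟨by linarith, le_rfl, fun d hd => absurd ⟨d, hd⟩ hne⟩

lemma psi_V1 (hC : ∀ r, |G.payoff i r| ≤ C) (hCM : C < M) (hw0 : |w0| ≤ M)
    (hII : ∀ x : ℕ → Yt G → ℝ, (x, fun n => sII (pre x (n+1))) ∉ auxW i h0 M w0)
    {l : List (Yt G)} {s : List (Yt G → ℝ) × ℝ}
    (hI : InvT i h0 M w0 sII l s.1 s.2) :
    V1 i (lastState (catH h0 l)) (psi i h0 M sII l s) ≤ s.2 := by
  by_contra hlt
  push Not at hlt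
  set ψ := psi i h0 M sII l s with hψ
  have hb := fun z => psi_bounds hC hCM hw0 hII hI z
  have habs : ∀ z, |ψ z| ≤ M := fun z => abs_le.2 ⟨by linarith [(hb z).1], (hb z).2.1⟩
  set η := min (V1 i (lastState (catH h0 l)) ψ - s.2) (M - C) with hη
  have hη0 : 0 < η := lt_min (by linarith) (by linarith)
  have hη1 : η ≤ V1 i (lastState (catH h0 l)) ψ - s.2 := min_le_left _ _
  have hη2 : η ≤ M - C := min_le_right _ _
  have hL : Leg i h0 M l s.2 (fun z => ψ z - η) := by
    refine ⟨fun z => abs_le.2 ⟨?_, ?_⟩, ?_⟩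
    · have := (hb z).1; linarith
    · have := (hb z).2.1; linarith
    · rw [V1_sub_const habs]; linarith
  have := (hb (sII (s.1 ++ [fun z => ψ z - η]))).2.2 _ ⟨hL, rfl⟩
  linarith

end II

end StochGame

open scoped ENNReal NNReal Classical
open MeasureTheory

namespace StochGame
variable {G : StochGame}
open BD

section II
variable {i : G.I} {h0 : G.History} {M w0 : ℝ} {sII : List (Yt G → ℝ) → Yt G} {δ : ℕ → ℝ} {C : ℝ}

lemma wv_abs (hM : 0 ≤ M) (hw0 : |w0| ≤ M) (l : List (Yt G)) : |wv i h0 M w0 sII δ l| ≤ M := by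
  rw [wv]
  cases h : trk i h0 M w0 sII δ l with
  | none => simp [abs_of_nonneg hM]
  | some s => exact inv_abs hw0 (trk_inv l s h)

/-- one-step bound -/
lemma wv_snoc (hδ : ∀ n, 0 < δ n) {l : List (Yt G)} {s : List (Yt G → ℝ) × ℝ}
    (hs : trk i h0 M w0 sII δ l = some s) (z : Yt G) :
    wv i h0 M w0 sII δ (l ++ [z]) ≤ psi i h0 M sII l s z + δ l.length := by
  rw [wv, trk_snoc, hs, Option.bind_some, stp]
  split_ifs with hh
  · exact hh.choose_spec.2
  · have hne : ¬ (Mv i h0 M sII l s z).Nonempty := fun hne =>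
      hh (exists_pick i h0 M sII l s z hne (hδ _))
    rw [psi, if_neg hne]
    have := hδ l.length
    simp only [Option.elim_none]; linarith

lemma trk_limit (hII : ∀ x : ℕ → Yt G → ℝ, (x, fun n => sII (pre x (n+1))) ∉ auxW i h0 M w0)
    (y : ℕ → Yt G) (hy : ∀ n, ∃ s, trk i h0 M w0 sII δ (pre y n) = some s) (N : ℕ) :
    ∃ n ≥ N, G.payoff i (runOf h0 y) ≤ wv i h0 M w0 sII δ (pre y n) := by
  choose s hs using hy
  have hI : ∀ n, InvT i h0 M w0 sII (pre y n) (s n).1 (s n).2 := fun n => trk_inv _ _ (hs n)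
  have hstep : ∀ n, ∃ d, (s (n+1)).1 = (s n).1 ++ [d] := by
    intro n
    have h1 := hs (n+1)
    rw [pre_succ, trk_snoc, hs n, Option.bind_some, stp] at h1
    split_ifs at h1 with hh
    have := Option.some.inj h1
    exact ⟨hh.choose, by rw [← this]⟩
  choose x hx using hstep
  have hpx : ∀ n, pre x n = (s n).1 := by
    intro n
    induction n with
    | zero =>
      have h1 := (hI 0).1
      rw [pre_length] at h1
      rw [List.length_eq_zero_iff.1 h1]; rfl
    | succ n ih => rw [pre_succ, ih, hx]
  have hlen : ∀ n, (pre y n).length = n := pre_length y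
  have hr : ∀ n, pre (resp sII x) n = pre y n := fun n => by
    have := ((hI n).2 x (by rw [hlen, hpx])).1
    rwa [hlen] at this
  have hry : resp sII x = y := by
    funext n
    have h1 := hr (n+1)
    rw [pre_succ, pre_succ, hr n] at h1
    simpa using h1
  have hleg : ∀ n, Leg i h0 M (pre y n) (tgt w0 x y n) (x n) := fun n => by
    have := ((hI (n+1)).2 x (by rw [hlen, hpx])).2.1 n (by rw [hlen]; omega)
    rwa [hry] at this
  have ht : ∀ n, tgt w0 x y n = wv i h0 M w0 sII δ (pre y n) := fun n => by
    have := ((hI n).2 x (by rw [hlen, hpx])).2.2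
    rw [hlen, hry] at this
    rw [this, wv, hs n]; rfl
  have hnot := hII x
  change (x, resp sII x) ∉ _ at hnot
  rw [hry] at hnot
  by_contra hcon
  push Not at hcon
  refine hnot ⟨hleg, fun k => ⟨N, fun n hn => ?_⟩⟩
  have h1 := hcon (n+1) (by omega)
  rw [← ht] at h1
  have h2 : (0:ℝ) ≤ 1/((k:ℝ)+1) := by positivity
  change x n (y n) ≤ G.payoff i (runOf h0 y) + _
  have h3 : tgt w0 x y (n+1) = x n (y n) := rfl
  linarith

lemma trk_none_mono (l : List (Yt G)) (z : Yt G) (h : trk i h0 M w0 sII δ l = none) :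
    trk i h0 M w0 sII δ (l ++ [z]) = none := by
  rw [trk_snoc, h]; rfl

variable {P : G.History → G.Profile → Measure G.Run}

lemma key_II (hP : IsInducedFamily G P) (hfm : Measurable (G.payoff i))
    (hC : ∀ r, |G.payoff i r| ≤ C) (hCM : C < M) (hw0 : |w0| ≤ M)
    (hII : ∀ x : ℕ → Yt G → ℝ, (x, fun n => sII (pre x (n+1))) ∉ auxW i h0 M w0)
    {η : ℝ} (hη : 0 < η) :
    ∃ σ : G.Profile, ∀ τ : G.Strategy i, expPay P h0 (Function.update σ i τ) i ≤ w0 + η := by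
  have hC0 : 0 ≤ C := (abs_nonneg _).trans (hC (runOf h0 fun _ => Classical.arbitrary _))
  set δ : ℕ → ℝ := fun n => η/4 * (1/2)^n with hδdef
  have hδ : ∀ n, 0 < δ n := fun n => by simp only [hδdef]; positivity
  have hx : ∀ l : List (Yt G), ∃ x : ∀ j, PMF (G.A j), ∀ s, trk i h0 M w0 sII δ l = some s →
      ∀ y : PMF (G.A i), ∫ z, psi i h0 M sII l s z ∂(mu (lastState (catH h0 l))
        (Function.update x i y)) ≤ s.2 + δ l.length := by
    intro l
    cases h : trk i h0 M w0 sII δ l with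
    | none => exact ⟨fun j => Classical.arbitrary _, fun s hs => by simp at hs⟩
    | some s =>
      have hI := trk_inv l s h
      have hb := fun z => psi_bounds hC hCM hw0 hII hI z
      have habs : ∀ z, |psi i h0 M sII l s z| ≤ M := fun z =>
        abs_le.2 ⟨by linarith [(hb z).1], (hb z).2.1⟩
      obtain ⟨x, hx⟩ := V1_exists_x (i := i) (t := lastState (catH h0 l)) habs (hδ l.length)
      refine ⟨x, fun s' hs' y => ?_⟩
      obtain rfl := Option.some.inj hs'
      have := psi_V1 hC hCM hw0 hII hI
      linarith [hx y]
  choose xo hxo using hx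
  refine ⟨fun j h => xo (h.2.drop h0.2.length) j, fun τ => ?_⟩
  set σ : G.Profile := Function.update (fun j h => xo (h.2.drop h0.2.length) j) i τ with hσ
  have hσl : ∀ l, (fun j => σ j (catH h0 l)) = Function.update (xo l) i (τ (catH h0 l)) := by
    intro l
    funext j
    by_cases hj : j = i
    · subst hj; simp [hσ]
    · simp [hσ, hj, catH]
  have := hP.1 h0 σ
  have hM : 0 ≤ M := by linarith
  have key := core_le h0 σ hP (u := fun l => - wv i h0 M w0 sII δ l) (C := M)
    (fun l => by rw [abs_neg]; exact wv_abs hM hw0 l) (δ := fun n => 2 * δ n)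
    (fun n => by have := hδ n; linarith) (S := η)
    (by
      intro n
      have h1 : ∑ k ∈ Finset.range n, 2 * δ k = η/2 * ∑ k ∈ Finset.range n, (1/2:ℝ)^k := by
        rw [Finset.mul_sum]
        refine Finset.sum_congr rfl fun k _ => ?_
        simp only [hδdef]; ring
      rw [h1]
      have h2 : ∑ k ∈ Finset.range n, (1/2:ℝ)^k ≤ 2 := sum_geometric_two_le n
      nlinarith)
    (by
      intro l _
      rw [hσl, integral_neg]
      have hb : ∀ z, |wv i h0 M w0 sII δ (l ++ [z])| ≤ M := fun z => wv_abs hM hw0 _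
      suffices h : ∫ z, wv i h0 M w0 sII δ (l ++ [z]) ∂(mu (lastState (catH h0 l))
          (Function.update (xo l) i (τ (catH h0 l)))) ≤ wv i h0 M w0 sII δ l + 2 * δ l.length by
        linarith
      cases h : trk i h0 M w0 sII δ l with
      | none =>
        have e1 : ∀ z, wv i h0 M w0 sII δ (l ++ [z]) = M := fun z => by
          rw [wv, trk_none_mono l z h]; rfl
        have e2 : wv i h0 M w0 sII δ l = M := by rw [wv, h]; rfl
        simp only [e1, e2, integral_const, probReal_univ, smul_eq_mul, one_mul]
        have := hδ l.length; linarith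
      | some s =>
        have e2 : wv i h0 M w0 sII δ l = s.2 := by rw [wv, h]; rfl
        have hI := trk_inv l s h
        have hb' := fun z => psi_bounds hC hCM hw0 hII hI z
        have habs : ∀ z, |psi i h0 M sII l s z| ≤ M := fun z =>
          abs_le.2 ⟨by linarith [(hb' z).1], (hb' z).2.1⟩
        have h1 := hxo l s h (τ (catH h0 l))
        set ν := mu (lastState (catH h0 l)) (Function.update (xo l) i (τ (catH h0 l))) with hν
        have iψ : Integrable (fun z => psi i h0 M sII l s z) ν := integrable_mu habs
        have iδ : Integrable (fun _ : Yt G => δ l.length) ν := integrable_const _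
        have h2 : ∫ z, wv i h0 M w0 sII δ (l ++ [z]) ∂ν ≤
            ∫ z, (psi i h0 M sII l s z + δ l.length) ∂ν :=
          integral_mono (integrable_mu hb) (iψ.add iδ) (fun z => wv_snoc hδ h z)
        have h3 := integral_add iψ iδ
        simp only [integral_const, probReal_univ, smul_eq_mul, one_mul] at h3
        rw [h3] at h2
        rw [e2]; linarith)
    (f := fun r => - G.payoff i r)
    (integrable_bdd (C := C) hfm.neg (fun r => by rw [abs_neg]; exact hC r))
    (by
      filter_upwards [ae_cyl h0 σ hP] with r hr c hc
      set y : ℕ → Yt G := fun k => r.2 (h0.2.length + k) with hy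
      have hr' : runOf h0 y = r := runOf_of_cyl h0 hr
      by_cases hall : ∀ n, ∃ s, trk i h0 M w0 sII δ (pre y n) = some s
      · by_contra hlt
        push Not at hlt
        have hev := hc.eventually (lt_mem_nhds hlt)
        obtain ⟨N, hN⟩ := Filter.eventually_atTop.1 hev
        obtain ⟨n, hn, h1⟩ := trk_limit hII y hall N
        have h2 := hN n hn
        rw [hr'] at h1
        change _ < - wv i h0 M w0 sII δ (pre y n) at h2
        linarith
      · push Not at hall
        obtain ⟨N, hN⟩ := hall
        have hnone : ∀ m, trk i h0 M w0 sII δ (pre y (N+m)) = none := by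
          intro m
          induction m with
          | zero =>
            exact Option.eq_none_iff_forall_ne_some.2 hN
          | succ m ih =>
            rw [← Nat.add_assoc, pre_succ]
            exact trk_none_mono _ _ ih
        have hc' : Filter.Tendsto (fun n => - wv i h0 M w0 sII δ (ln h0 n r)) Filter.atTop
            (nhds (-M)) := by
          refine tendsto_const_nhds.congr' ?_
          filter_upwards [Filter.eventually_ge_atTop N] with n hn
          obtain ⟨m, rfl⟩ := Nat.exists_eq_add_of_le hn
          have : trk i h0 M w0 sII δ (ln h0 (N+m) r) = none := hnone m
          rw [wv, this]; rfl
        have := tendsto_nhds_unique hc hc'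
        have h1 := (abs_le.1 (hC r)).2
        linarith)
  have e0 : wv i h0 M w0 sII δ [] = w0 := by rw [wv, trk_nil]; rfl
  rw [integral_neg] at key
  simp only [e0] at key
  change ∫ r, G.payoff i r ∂(P h0 σ) ≤ _
  linarith

lemma abs_expPay_le (hP : IsInducedFamily G P) (hC : ∀ r, |G.payoff i r| ≤ C) (h : G.History)
    (σ : G.Profile) : |expPay P h σ i| ≤ C := by
  have := hP.1 h σ
  have := norm_integral_le_of_norm_le_const (μ := P h σ) (f := G.payoff i) (C := C)
    (Filter.Eventually.of_forall hC)
  simpa [expPay] using this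

lemma mm_bddA (hP : IsInducedFamily G P) (hC : ∀ r, |G.payoff i r| ≤ C) (h : G.History)
    (σ : G.Profile) : BddAbove (Set.range fun τ : G.Strategy i =>
      expPay P h (Function.update σ i τ) i) :=
  ⟨C, by rintro _ ⟨τ, rfl⟩; exact (abs_le.1 (abs_expPay_le hP hC _ _)).2⟩

lemma mm_bddB (hP : IsInducedFamily G P) (hC : ∀ r, |G.payoff i r| ≤ C) (h : G.History) :
    BddBelow (Set.range fun σ : G.Profile => ⨆ τ : G.Strategy i,
      expPay P h (Function.update σ i τ) i) :=
  ⟨-C, by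
    rintro _ ⟨σ, rfl⟩
    exact le_ciSup_of_le (mm_bddA hP hC h σ) (fun _ => Classical.arbitrary _)
      (abs_le.1 (abs_expPay_le hP hC _ _)).1⟩

lemma abs_mm (hP : IsInducedFamily G P) (hC : ∀ r, |G.payoff i r| ≤ C) (h : G.History) :
    |minmaxVal P i h| ≤ C := by
  rw [abs_le]
  constructor
  · refine le_ciInf fun σ => ?_
    exact le_ciSup_of_le (mm_bddA hP hC h σ) (fun _ => Classical.arbitrary _)
      (abs_le.1 (abs_expPay_le hP hC _ _)).1
  · refine ciInf_le_of_le (mm_bddB hP hC h) (fun _ _ => Classical.arbitrary _) ?_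
    exact ciSup_le fun τ => (abs_le.1 (abs_expPay_le hP hC _ _)).2

/-- **Key Lemma** -/
theorem key_lemma (hP : IsInducedFamily G P) (hfm : Measurable (G.payoff i))
    (hC : ∀ r, |G.payoff i r| ≤ C) (hCM : C < M) (hw0 : |w0| ≤ M)
    (hlt : w0 < minmaxVal P i h0) : ∃ d, KeyD i h0 M w0 d := by
  rcases gs_det (auxW_meas i hfm h0 M w0) with ⟨sI, hs⟩ | ⟨sII, hs⟩
  · exact key_of_I hw0 hs
  · exfalso
    obtain ⟨σ, hσ⟩ := key_II hP hfm hC hCM hw0 hs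
      (η := (minmaxVal P i h0 - w0)/2) (by linarith)
    have h1 : minmaxVal P i h0 ≤ ⨆ τ : G.Strategy i, expPay P h0 (Function.update σ i τ) i :=
      ciInf_le (mm_bddB hP hC h0) σ
    have h2 : ⨆ τ : G.Strategy i, expPay P h0 (Function.update σ i τ) i ≤
        w0 + (minmaxVal P i h0 - w0)/2 := ciSup_le hσ
    linarith

end II
end StochGame

open scoped ENNReal NNReal Classical
open MeasureTheory

namespace StochGame
variable {G : StochGame}
open BD

section D
variable (dd : G.History → List (Yt G) → ℝ) (v : G.History → ℝ) (ε : ℝ)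

/-- last restart time, on reversed lists -/
noncomputable def strt' (s : G.S) : List (Yt G) → List (Yt G)
  | [] => []
  | z :: m =>
    if dd (s, strt' s m) ((m.reverse ++ [z]).drop (strt' s m).length) <
      v (s, m.reverse ++ [z]) - ε then m.reverse ++ [z] else strt' s m

noncomputable def strt (s : G.S) (l : List (Yt G)) : List (Yt G) := strt' dd v ε s l.reverse

lemma strt_nil (s : G.S) : strt dd v ε s [] = [] := rfl

lemma strt_snoc (s : G.S) (l : List (Yt G)) (z : Yt G) : strt dd v ε s (l ++ [z]) =
    if dd (s, strt dd v ε s l) ((l ++ [z]).drop (strt dd v ε s l).length) <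
      v (s, l ++ [z]) - ε then l ++ [z] else strt dd v ε s l := by
  rw [strt, List.reverse_append]
  change strt' dd v ε s (z :: l.reverse) = _
  rw [strt', List.reverse_reverse]
  rfl

lemma strt_pfx (s : G.S) (l : List (Yt G)) : strt dd v ε s l <+: l := by
  induction l using List.reverseRecOn with
  | nil => simp [strt_nil]
  | append_singleton l z ih =>
    rw [strt_snoc]
    split_ifs
    · exact List.prefix_rfl
    · exact ih.trans (List.prefix_append _ _)

/-- restart histories -/
def Rst (h : G.History) : Prop := h.2 ≠ [] ∧ strt dd v ε h.1 h.2 = h.2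

noncomputable def pot (h : G.History) : ℝ :=
  dd (h.1, strt dd v ε h.1 h.2) (h.2.drop (strt dd v ε h.1 h.2).length)

/-- the Martin function -/
noncomputable def MD (h : G.History) : ℝ := if Rst dd v ε h then v h - ε else pot dd v ε h

lemma not_rst_snoc (s : G.S) (l : List (Yt G)) (z : Yt G) :
    Rst dd v ε (s, l ++ [z]) ↔
      dd (s, strt dd v ε s l) ((l ++ [z]).drop (strt dd v ε s l).length) <
        v (s, l ++ [z]) - ε := by
  unfold Rst
  simp only [strt_snoc]
  split_ifs with h
  · simp [h]
  · simp only [h, iff_false, not_and]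
    intro _ he
    have h1 := (strt_pfx dd v ε s l).length_le
    rw [he] at h1
    simp at h1

lemma strt_snoc_of_not (s : G.S) (l : List (Yt G)) (z : Yt G) (h : ¬ Rst dd v ε (s, l ++ [z])) :
    strt dd v ε s (l ++ [z]) = strt dd v ε s l := by
  rw [not_rst_snoc] at h
  rw [strt_snoc, if_neg h]

lemma dd_le_MD (s : G.S) (l : List (Yt G)) (z : Yt G) :
    dd (s, strt dd v ε s l) ((l ++ [z]).drop (strt dd v ε s l).length) ≤
      MD dd v ε (s, l ++ [z]) := by
  unfold MD
  split_ifs with h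
  · exact ((not_rst_snoc dd v ε s l z).1 h).le
  · simp only [pot]
    rw [strt_snoc_of_not dd v ε s l z h]

variable {dd v ε} {i : G.I} {M C : ℝ}
variable (hdd : ∀ h, KeyD i h M (v h - ε/2) (dd h)) (hε : 0 < ε)

lemma pot_eq (hdd : ∀ h, KeyD i h M (v h - ε/2) (dd h)) (h : G.History) :
    pot dd v ε h = MD dd v ε h + (if Rst dd v ε h then ε/2 else 0) := by
  unfold MD
  split_ifs with hR
  · have : pot dd v ε h = dd h [] := by
      unfold pot
      rw [hR.2]; simp
    rw [this, (hdd h).1]; ring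
  · simp

lemma MD_lower (hdd : ∀ h, KeyD i h M (v h - ε/2) (dd h)) (hε : 0 < ε) (h : G.History) :
    v h - ε ≤ MD dd v ε h := by
  unfold MD
  split_ifs with hR
  · exact le_rfl
  · obtain ⟨s, l⟩ := h
    rcases List.eq_nil_or_concat l with rfl | ⟨l, z, rfl⟩
    · simp only [pot, strt_nil, List.length_nil, List.drop_nil]
      rw [(hdd _).1]; linarith
    · rw [List.concat_eq_append] at hR ⊢
      simp only [pot]
      rw [strt_snoc_of_not dd v ε s l z hR]
      rw [not_rst_snoc] at hR
      exact not_lt.1 hR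

lemma MD_abs (hdd : ∀ h, KeyD i h M (v h - ε/2) (dd h)) (hv : ∀ h, |v h - ε| ≤ M)
    (h : G.History) : |MD dd v ε h| ≤ M := by
  unfold MD
  split_ifs with hR
  · exact hv h
  · exact (hdd _).2.1 _

lemma pot_le_V1 (hdd : ∀ h, KeyD i h M (v h - ε/2) (dd h)) (hv : ∀ h, |v h - ε| ≤ M)
    (h : G.History) :
    pot dd v ε h ≤ V1 i (lastState h) (fun z => MD dd v ε (snocH h z.1 z.2)) := by
  obtain ⟨s, l⟩ := h
  set p := strt dd v ε s l with hp
  have hpl : p ++ l.drop p.length = l := List.prefix_iff_eq_append.1 (strt_pfx dd v ε s l)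
  have h1 := (hdd (s, p)).2.2.1 (l.drop p.length)
  have e : catH ((s, p) : G.History) (l.drop p.length) = (s, l) := by simp [catH, hpl]
  rw [e] at h1
  refine h1.trans (V1_mono (fun z => (hdd _).2.1 _) (fun z => MD_abs hdd hv _) fun z => ?_)
  have h2 := dd_le_MD dd v ε s l z
  rw [← hp, List.drop_append_of_le_length (strt_pfx dd v ε s l).length_le] at h2
  exact h2

lemma pre_pfx {Z : Type} {z : ℕ → Z} {n : ℕ} {p : List Z} (hp : p <+: pre z n) :
    pre z p.length = p := by
  have h1 := hp.length_le
  rw [pre_length] at h1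
  have h2 := List.prefix_iff_eq_take.1 hp
  conv_rhs => rw [h2]
  simp [pre, ← List.map_take, List.take_range, h1]

lemma pre_drop {Z : Type} (z : ℕ → Z) (m n : ℕ) :
    (pre z (m + n)).drop m = pre (fun k => z (m + k)) n := by
  induction n with
  | zero => rw [List.drop_of_length_le (by rw [pre_length]; omega)]; rfl
  | succ n ih =>
    rw [← Nat.add_assoc, pre_succ, pre_succ,
      List.drop_append_of_le_length (by rw [pre_length]; omega), ih]

lemma MD_limit (hdd : ∀ h, KeyD i h M (v h - ε/2) (dd h)) (r : G.Run)
    (hR : ∀ᶠ n in Filter.atTop, ¬ Rst dd v ε (r.1, pre r.2 n)) {c : ℝ}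
    (hc : Filter.Tendsto (fun n => MD dd v ε (r.1, pre r.2 n)) Filter.atTop (nhds c)) :
    c ≤ G.payoff i r := by
  obtain ⟨N, hN⟩ := Filter.eventually_atTop.1 hR
  set p := strt dd v ε r.1 (pre r.2 N) with hp
  have hst : ∀ m, strt dd v ε r.1 (pre r.2 (N+m)) = p := by
    intro m
    induction m with
    | zero => rfl
    | succ m ih =>
      rw [← Nat.add_assoc, pre_succ, strt_snoc_of_not, ih]
      rw [← pre_succ]; exact hN _ (by omega)
  have hpp : pre r.2 p.length = p := pre_pfx (strt_pfx dd v ε r.1 (pre r.2 N))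
  have hcyl : r ∈ cyl ((r.1, p) : G.History) := by
    refine ⟨rfl, ?_⟩
    exact (pre_eq_iff r.2 p).1 hpp
  have hrun := runOf_of_cyl _ hcyl
  set y : ℕ → Yt G := fun k => r.2 (p.length + k) with hy
  have hval : ∀ n ≥ N, ∀ m, n = p.length + m → MD dd v ε (r.1, pre r.2 n) =
      dd (r.1, p) (pre y m) := by
    rintro n hn m rfl
    obtain ⟨q, hq⟩ := Nat.exists_eq_add_of_le hn
    unfold MD
    rw [if_neg (hN _ hn)]
    simp only [pot]
    have h1 := hst q
    rw [← hq] at h1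
    rw [h1, pre_drop]
  refine le_of_forall_pos_le_add fun e he => ?_
  obtain ⟨k, hk⟩ := exists_nat_one_div_lt he
  obtain ⟨N', hN'⟩ := (hdd (r.1, p)).2.2.2 y k
  refine le_of_tendsto hc ?_
  filter_upwards [Filter.eventually_ge_atTop (N + p.length + N')] with n hn
  rw [hval n (by omega) (n - p.length) (by omega)]
  have h1 := hN' (n - p.length) (by omega)
  have h2 : runOf ((r.1, p) : G.History) y = r := hrun
  rw [h2] at h1
  linarith

variable {P : G.History → G.Profile → Measure G.Run}

lemma pre_cyl {h : G.History} {r : G.Run} (hr : r ∈ cyl h) (n : ℕ) :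
    catH h (ln h n r) = (r.1, pre r.2 (h.2.length + n)) := by
  induction n with
  | zero =>
    have := (pre_eq_iff r.2 h.2).2 hr.2
    have e : ln h 0 r = [] := rfl
    rw [e, catH_nil, Nat.add_zero, this, hr.1]
  | succ n ih => rw [ln_succ, ← catH_catH, ih, ← Nat.add_assoc, pre_succ]; rfl

/-- evaluation of a profile that is almost one-shot optimal -/
lemma MD_eval (hP : IsInducedFamily G P) (hfm : Measurable (G.payoff i))
    (hC : ∀ r, |G.payoff i r| ≤ C)
    (hdd : ∀ h, KeyD i h M (v h - ε/2) (dd h)) (hε : 0 < ε) (hv : ∀ h, |v h - ε| ≤ M)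
    (h : G.History) (σ : G.Profile) {u0 : ℝ} (hu0 : |u0| ≤ M)
    {δ : ℕ → ℝ} (hδ : ∀ n, 0 ≤ δ n) {S : ℝ} (hS : ∀ n, ∑ k ∈ Finset.range n, δ k ≤ S)
    (h0 : u0 - δ 0 ≤ ∫ z, MD dd v ε (snocH h z.1 z.2) ∂(mu (lastState h) (fun j => σ j h)))
    (h1 : ∀ l, contProb σ h l ≠ 0 →
      V1 i (lastState (catH h l)) (fun z => MD dd v ε (snocH (catH h l) z.1 z.2)) - δ l.length ≤
      ∫ z, MD dd v ε (snocH (catH h l) z.1 z.2)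
        ∂(mu (lastState (catH h l)) (fun j => σ j (catH h l)))) :
    u0 - S ≤ expPay P h σ i := by
  have := hP.1 h σ
  set u : List (Yt G) → ℝ := fun l => if l = [] then u0 else MD dd v ε (catH h l) with hu
  have hus : ∀ l z, u (l ++ [z]) = MD dd v ε (snocH (catH h l) z.1 z.2) := fun l z => by
    simp [hu, snocH_catH]
  have hub : ∀ l, |u l| ≤ M := fun l => by
    simp only [hu]; split_ifs
    · exact hu0
    · exact MD_abs hdd hv _
  set R : Set (List (Yt G)) := {l | l ≠ [] ∧ Rst dd v ε (catH h l)} with hRd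
  have hstep : ∀ l, contProb σ h l ≠ 0 →
      u l + R.indicator (fun _ => ε/2) l - δ l.length ≤
        ∫ z, u (l ++ [z]) ∂(mu (lastState (catH h l)) (fun j => σ j (catH h l))) := by
    intro l hl
    simp only [hus]
    by_cases hln : l = []
    · subst hln
      have e : R.indicator (fun _ => ε/2) ([] : List (Yt G)) = 0 :=
        Set.indicator_of_notMem (fun hh => hh.1 rfl) _
      rw [e, catH_nil]
      simpa [hu] using h0
    · have h2 := h1 l hl
      have h3 := pot_le_V1 hdd hv (catH h l)
      rw [pot_eq hdd] at h3
      have e1 : u l = MD dd v ε (catH h l) := by simp [hu, hln]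
      have e2 : R.indicator (fun _ => ε/2) l =
          if Rst dd v ε (catH h l) then ε/2 else 0 := by
        simp [Set.indicator, hRd, hln]
      rw [e1, e2]
      linarith
  have hr := core_restart h σ hP hub hδ hS R (half_pos hε) hstep
  have hfin := core_le h σ hP hub hδ hS (f := G.payoff i) (by
      intro l hl
      have h2 := hstep l hl
      have h3 : 0 ≤ R.indicator (fun _ => ε/2) l :=
        Set.indicator_nonneg (fun _ _ => (half_pos hε).le) l
      linarith) (integrable_bdd hfm hC) (by
      filter_upwards [hr, ae_cyl h σ hP] with r hr hcy c hc
      have hne : ∀ n, 1 ≤ n → ln h n r ≠ [] := fun n hn h0 => by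
        have := ln_length h n r
        rw [h0] at this; simp at this; omega
      refine MD_limit hdd r ?_ ?_
      · obtain ⟨N, hN⟩ := Filter.eventually_atTop.1 hr
        filter_upwards [Filter.eventually_ge_atTop (h.2.length + N + 1)] with n hn hRn
        obtain ⟨m, rfl⟩ := Nat.exists_eq_add_of_le (show h.2.length ≤ n by omega)
        refine hN m (by omega) ⟨hne m (by omega), ?_⟩
        rw [pre_cyl hcy]; exact hRn
      · rw [← Filter.tendsto_add_atTop_iff_nat h.2.length]
        refine hc.congr' ?_
        filter_upwards [Filter.eventually_ge_atTop 1] with n hn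
        rw [Nat.add_comm n, ← pre_cyl hcy]
        simp [hu, hne n hn])
  have e0 : u [] = u0 := by simp [hu]
  rw [e0] at hfin
  exact hfin

end D

lemma ext_trans {a b c : G.History} (h1 : Ext a b) (h2 : Ext b c) : Ext a c :=
  ⟨h1.1.trans h2.1, h1.2.trans h2.2⟩

theorem martin_aux (G : StochGame)
    (P : G.History → G.Profile → Measure G.Run) (hP : IsInducedFamily G P)
    (hfm : ∀ i, Measurable (G.payoff i))
    (hfb : ∀ i, ∃ C : ℝ, ∀ r : G.Run, |G.payoff i r| ≤ C)
    (ε : ℝ) (hε : 0 < ε) (i : G.I) :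
    ∃ D : G.History → ℝ,
      (∃ C : ℝ, ∀ h : G.History, |D h| ≤ C) ∧
      (∀ h : G.History, Valid h → minmaxVal P i h - ε ≤ D h ∧ D h ≤ minmaxVal P i h) ∧
      (∀ h : G.History, Valid h → D h ≤ oneShotMinmax D i h) ∧
      (∀ h' : G.History, Valid h' → ∀ σ : G.Profile,
        (∀ h : G.History, Valid h → Ext h' h →
          oneShotMinmax D i h ≤ oneShotExp D h (fun j => σ j h)) →
        (∀ h : G.History, Valid h → Ext h' h →
          oneShotMinmax D i h ≤ expPay P h σ i)) := by
  obtain ⟨C, hC⟩ := hfb i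
  have hC0 : 0 ≤ C := (abs_nonneg _).trans
    (hC (Classical.arbitrary _, fun _ => Classical.arbitrary _))
  set v := minmaxVal P i with hvd
  have hvb : ∀ h, |v h| ≤ C := fun h => abs_mm hP hC h
  set M := C + ε with hM
  have hex : ∀ h, ∃ d, KeyD i h M (v h - ε/2) d := fun h =>
    key_lemma hP (hfm i) hC (by linarith) (by
      have := abs_le.1 (hvb h)
      rw [abs_le]; constructor <;> linarith) (show v h - ε/2 < v h by linarith)
  choose dd hdd using hex
  have hv : ∀ h, |v h - ε| ≤ M := fun h => by
    have := abs_le.1 (hvb h)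
    rw [abs_le]; constructor <;> linarith
  set D := MD dd v ε with hD
  have hDb : ∀ h, |D h| ≤ M := MD_abs hdd hv
  have hV : ∀ h, D h ≤ V1 i (lastState h) (fun z => D (snocH h z.1 z.2)) := fun h => by
    have h1 := pot_le_V1 hdd hv h
    rw [pot_eq hdd] at h1
    have h2 : 0 ≤ if Rst dd v ε h then ε/2 else 0 := by split_ifs <;> linarith
    linarith
  refine ⟨D, ⟨M, hDb⟩, fun h _ => ⟨MD_lower hdd hε h, ?_⟩, fun h _ => ?_, ?_⟩
  · -- upper bound
    refine le_of_forall_pos_le_add fun η hη => ?_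
    rw [← sub_le_iff_le_add]
    refine le_ciInf fun σ => ?_
    set δ : ℕ → ℝ := fun n => η/2 * (1/2)^n with hδdef
    have hδ : ∀ n, 0 < δ n := fun n => by simp only [hδdef]; positivity
    have hS : ∀ n, ∑ k ∈ Finset.range n, δ k ≤ η := by
      intro n
      simp only [hδdef, ← Finset.mul_sum]
      have h2 : ∑ k ∈ Finset.range n, (1/2:ℝ)^k ≤ 2 := sum_geometric_two_le n
      nlinarith
    have hy : ∀ g : G.History, ∃ y : PMF (G.A i),
        V1 i (lastState g) (fun z => D (snocH g z.1 z.2)) - δ (g.2.length - h.2.length) ≤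
        ∫ z, D (snocH g z.1 z.2) ∂(mu (lastState g) (Function.update (fun j => σ j g) i y)) :=
      fun g => V1_exists_y (fun z => hDb _) (hδ _) _
    choose τ hτ using hy
    have hσg : ∀ g, (fun j => Function.update σ i τ j g) =
        Function.update (fun j => σ j g) i (τ g) := by
      intro g; funext j
      by_cases hj : j = i
      · subst hj; simp
      · simp [hj]
    refine le_ciSup_of_le (mm_bddA hP hC h σ) τ ?_
    refine MD_eval hP (hfm i) hC hdd hε hv h _ (hDb h) (fun n => (hδ n).le) hS ?_ ?_
    · have h1 := hτ h
      rw [hσg]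
      have h2 := hV h
      rw [Nat.sub_self] at h1
      linarith
    · intro l _
      have h1 := hτ (catH h l)
      rw [hσg]
      have e : (catH h l).2.length - h.2.length = l.length := by simp [catH]
      rw [e] at h1
      exact h1
  · rw [oneShotMinmax_eq hDb]; exact hV h
  · intro h' _ σ hσ h hval hext
    have key := MD_eval hP (hfm i) hC hdd hε hv h σ (u0 := oneShotMinmax D i h)
      (by
        rw [oneShotMinmax_eq hDb, abs_le]
        exact ⟨le_V1 (fun z => hDb _) fun z => (abs_le.1 (hDb _)).1,
          V1_le (fun z => hDb _) fun z => (abs_le.1 (hDb _)).2⟩)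
      (δ := fun _ => 0) (fun _ => le_rfl) (S := 0) (fun n => by simp)
      (by
        have := hσ h hval hext
        rw [oneShotExp_eq hDb] at this
        simpa using this)
      (by
        intro l hl
        have := hσ (catH h l) (valid_of_contProb σ h hval l hl) (ext_trans hext (ext_catH h l))
        rw [oneShotExp_eq hDb, oneShotMinmax_eq hDb] at this
        simpa using this)
    simpa using key

end StochGame



namespace StochGame

/-- **Theorem (Martin function for the minmax value).**
In every stochastic game, for every `ε > 0` and every player `i`, there is a bounded
function `D : H → ℝ` such that:
(1) `v̄_i(h) - ε ≤ D h ≤ v̄_i(h)` for every history `h`;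
(2) `D h ≤ v̄_{O,i}(D, h)` for every history `h`;
(3) for every history `h'` and strategy profile `σ`, if
`v̄_{O,i}(D,h) ≤ E[D | h, σ(h)]` for every history `h` extending `h'` (including `h'`),
then `v̄_{O,i}(D,h) ≤ E_{h,σ}[f_i]` for every history `h` extending `h'` (including `h'`). -/
theorem exists_martin_function_minmax (G : StochGame)
    (P : G.History → G.Profile → Measure G.Run) (hP : IsInducedFamily G P)
    (hfm : ∀ i, Measurable (G.payoff i))
    (hfb : ∀ i, ∃ C : ℝ, ∀ r : G.Run, |G.payoff i r| ≤ C)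
    (ε : ℝ) (hε : 0 < ε) (i : G.I) :
    ∃ D : G.History → ℝ,
      (∃ C : ℝ, ∀ h : G.History, |D h| ≤ C) ∧
      (∀ h : G.History, Valid h → minmaxVal P i h - ε ≤ D h ∧ D h ≤ minmaxVal P i h) ∧
      (∀ h : G.History, Valid h → D h ≤ oneShotMinmax D i h) ∧
      (∀ h' : G.History, Valid h' → ∀ σ : G.Profile,
        (∀ h : G.History, Valid h → Ext h' h →
          oneShotMinmax D i h ≤ oneShotExp D h (fun j => σ j h)) →
        (∀ h : G.History, Valid h → Ext h' h →
          oneShotMinmax D i h ≤ expPay P h σ i)) := by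
  exact martin_aux G P hP hfm hfb ε hε i

end StochGame
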